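/- arXiv:2202.11293 — 3 statements merged into one kernel-verified Lean document; each statement's English description precedes it below -/
import Mathlib

section
/- If α is a Liouville number with α ≥ 1, then arccosh α = log(α + √(α² − 1)) is transcendental. -/
namespace LA

noncomputable section

open scoped Nat
open Complex Polynomial

/--
`P` is a slightly generalized version of `Iᵢ` in
[the wikipedia proof](https://en.wikipedia.org/wiki/Lindemann%E2%80%93Weierstrass_theorem):
`Iᵢ(s) = P(fᵢ, s)`.
-/
def PP (f : ℂ[X]) (s : ℂ) :=
  exp s * f.sumIDeriv.eval 0 - f.sumIDeriv.eval s

theorem PP_eq_integral_exp_mul_eval (f : ℂ[X]) (s : ℂ) :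
    PP f s = exp s * (s * ∫ x in 0..1, exp (-(x • s)) * f.eval (x • s)) := by
  rw [LindemannWeierstrass.integral_exp_mul_eval, mul_add, mul_neg, exp_neg, mul_inv_cancel_left₀ (exp_ne_zero s),
    neg_add_eq_sub, PP]

/--
Given a sequence of complex polynomials `fₚ`, a complex constant `s`, and a real constant `c` such
that `|fₚ(xs)| ≤ c ^ p` for all `p ∈ ℕ` and `x ∈ Ioc 0 1`, then there is also a nonnegative
constant `c'` such that for all nonzero `p ∈ ℕ`, `|P(fₚ, s)| ≤ c' ^ p`.
-/
theorem PP_le_aux (f : ℕ → ℂ[X]) (s : ℂ) (c : ℝ)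
    (hc : ∀ p : ℕ, ∀ x ∈ Set.Ioc (0 : ℝ) 1, ‖(f p).eval (x • s)‖ ≤ c ^ p) :
    ∃ c' ≥ 0, ∀ p : ℕ,
      ‖PP (f p) s‖ ≤
        Real.exp s.re * (Real.exp ‖s‖ * c' ^ p * ‖s‖) := by
  refine ⟨|c|, abs_nonneg _, fun p => ?_⟩
  rw [PP_eq_integral_exp_mul_eval (f p) s, mul_comm s, norm_mul, norm_mul, norm_exp]
  gcongr
  rw [intervalIntegral.integral_of_le zero_le_one, ← mul_one (_ * _)]
  convert! MeasureTheory.norm_setIntegral_le_of_norm_le_const _ _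
  · rw [Real.volume_real_Ioc_of_le zero_le_one, sub_zero]
  · rw [Real.volume_Ioc, sub_zero]; exact ENNReal.ofReal_lt_top
  intro x hx
  rw [norm_mul, norm_exp]
  gcongr
  · simp only [Set.mem_Ioc] at hx
    apply (re_le_norm _).trans
    rw [norm_neg, norm_smul, Real.norm_of_nonneg hx.1.le]
    exact mul_le_of_le_one_left (norm_nonneg _) hx.2
  · rw [← abs_pow]
    exact (hc p x hx).trans (le_abs_self _)

/--
Given a sequence of complex polynomials `fₚ`, a complex constant `s`, and a real constant `c` such
that `|fₚ(xs)| ≤ c ^ p` for all `p ∈ ℕ` and `x ∈ Ioc 0 1`, then there is also a nonnegative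
constant `c'` such that for all nonzero `p ∈ ℕ`, `|P(fₚ, s)| ≤ c' ^ p`.
-/
theorem PP_le (f : ℕ → ℂ[X]) (s : ℂ) (c : ℝ)
    (hc : ∀ p : ℕ, ∀ x ∈ Set.Ioc (0 : ℝ) 1, ‖(f p).eval (x • s)‖ ≤ c ^ p) :
    ∃ c' ≥ 0, ∀ p ≠ 0, ‖PP (f p) s‖ ≤ c' ^ p := by
  obtain ⟨c', hc', h'⟩ := PP_le_aux f s c hc; clear c hc
  let c₁ := max (Real.exp s.re) 1
  let c₂ := max (Real.exp ‖s‖) 1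
  let c₃ := max ‖s‖ 1
  use c₁ * (c₂ * c' * c₃), by positivity
  intro p hp
  refine (h' p).trans ?_
  simp_rw [mul_pow]
  have le_max_one_pow {x : ℝ} : x ≤ max x 1 ^ p :=
    (max_cases x 1).elim (fun h ↦ h.1.symm ▸ le_self_pow₀ h.2 hp)
      fun h ↦ by rw [h.1, one_pow]; exact h.2.le
  gcongr <;> exact le_max_one_pow

/--
Given a polynomial with integer coefficients `p` and a complex constant `s`, there is a nonnegative
`c` such that for all nonzero `q ∈ ℕ`, `|P(X ^ (q - 1) * p ^ q, s)| ≤ c ^ q`.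

Note: Jacobson writes `h(x)` for `x ^ (q - 1) * p(x) ^ q` and `bⱼ` for its coefficients.
-/
theorem exp_approx_aux (f : ℤ[X]) (s : ℂ) :
    ∃ c ≥ 0,
      ∀ p ≠ 0, ‖PP (map (algebraMap ℤ ℂ) (X ^ (p - 1) * f ^ p)) s‖ ≤ c ^ p := by
  have : Bornology.IsBounded
      ((fun x : ℝ ↦ max (x * ‖s‖) 1 * ‖aeval (x * s) f‖) '' Set.Ioc 0 1) := by
    have h :
      (fun x : ℝ ↦ max (x * ‖s‖) 1 * ‖aeval (x * s) f‖) '' Set.Ioc 0 1 ⊆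
        (fun x : ℝ ↦ max (x * ‖s‖) 1 * ‖aeval (x * s) f‖) '' Set.Icc 0 1 :=
      Set.image_mono Set.Ioc_subset_Icc_self
    refine (IsCompact.image isCompact_Icc ?_).isBounded.subset h
    fun_prop
  obtain ⟨c, h⟩ := this.exists_norm_le
  simp_rw [Real.norm_eq_abs] at h
  refine PP_le _ s c (fun p x hx => ?_)
  specialize h (max (x * ‖s‖) 1 * ‖aeval (x * s) f‖) (Set.mem_image_of_mem _ hx)
  grw [← h]
  simp_rw [Polynomial.map_mul, Polynomial.map_pow, map_X, eval_mul, eval_pow, eval_X, norm_mul,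
    Complex.norm_pow, real_smul, norm_mul, norm_real, ← eval₂_eq_eval_map, ← aeval_def, abs_mul,
    abs_norm, mul_pow, Real.norm_of_nonneg hx.1.le]
  refine mul_le_mul_of_nonneg_right ?_ (pow_nonneg (norm_nonneg _) _)
  rw [← mul_pow, abs_of_nonneg (by positivity), max_def]
  split_ifs with hx1
  · rw [one_pow]
    exact pow_le_one₀ (mul_nonneg hx.1.le (norm_nonneg _)) hx1
  · push Not at hx1
    exact pow_le_pow_right₀ hx1.le (Nat.sub_le _ _)

theorem coeff_pow_bound (f : ℤ[X]) (M : ℕ) (hM : (f.sum fun _ a => a.natAbs) ≤ M) (p : ℕ) :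
    ∀ k, ((f ^ p).coeff k).natAbs ≤ M ^ p := by
  induction p with
  | zero =>
    intro k
    rw [pow_zero, coeff_one]
    split_ifs <;> simp
  | succ p ih =>
    intro k
    rw [pow_succ', coeff_mul, Finset.Nat.sum_antidiagonal_eq_sum_range_succ
      (fun i j => f.coeff i * (f ^ p).coeff j)]
    refine (Int.natAbs_sum_le _ _).trans ?_
    calc _ ≤ ∑ i ∈ Finset.range k.succ, (f.coeff i).natAbs * M ^ p := by
            refine Finset.sum_le_sum fun i _ => ?_
            rw [Int.natAbs_mul]
            exact Nat.mul_le_mul_left _ (ih _)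
      _ = (∑ i ∈ Finset.range k.succ, (f.coeff i).natAbs) * M ^ p := by rw [Finset.sum_mul]
      _ ≤ M * M ^ p := by
            refine Nat.mul_le_mul_right _ (le_trans ?_ hM)
            rw [Polynomial.sum_def]
            refine Finset.sum_le_sum_of_ne_zero fun i _ h => ?_
            rw [mem_support_iff]
            intro h0
            simp [h0] at h
      _ = M ^ (p + 1) := by rw [pow_succ']

theorem eval_zero_sumIDeriv_bound (h : ℤ[X]) (H m : ℕ) (hH : ∀ k, (h.coeff k).natAbs ≤ H)
    (hm : h.natDegree + 1 ≤ m) : ((sumIDeriv h).eval 0).natAbs ≤ m ! * H := by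
  rw [sumIDeriv_apply, eval_finsetSum]
  refine (Int.natAbs_sum_le _ _).trans ?_
  calc _ ≤ ∑ i ∈ Finset.range (h.natDegree + 1), (h.natDegree)! * H := by
        refine Finset.sum_le_sum fun i hi => ?_
        rw [← coeff_zero_eq_eval_zero, coeff_iterate_derivative, zero_add, nsmul_eq_mul,
          Int.natAbs_mul, Int.natAbs_natCast, Nat.descFactorial_self]
        exact Nat.mul_le_mul (Nat.factorial_le (by simpa [Nat.lt_succ_iff] using hi)) (hH _)
    _ = (h.natDegree + 1)! * H := by
        rw [Finset.sum_const, Finset.card_range, smul_eq_mul, Nat.factorial_succ, mul_assoc]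
    _ ≤ _ := Nat.mul_le_mul_right _ (Nat.factorial_le hm)

theorem exp_approx (f : ℤ[X]) (hf : f.eval 0 ≠ 0) :
    ∃ (c : ℝ) (M : ℕ),
      ∀ p > (eval 0 f).natAbs, p.Prime →
        ∃ n : ℤ, ¬ ↑p ∣ n ∧ n.natAbs ≤ (p * (f.natDegree + 1))! * M ^ p ∧
          ∃ gp : ℤ[X], gp.natDegree ≤ p * f.natDegree - 1 ∧
          ∀ {r : ℂ}, r ∈ f.aroots ℂ →
            ‖n • exp r - p • aeval r gp‖ ≤ c ^ p / (p - 1)! := by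
  obtain ⟨M, hM⟩ : ∃ M : ℕ, (f.sum fun _ a => a.natAbs) ≤ M := ⟨_, le_rfl⟩
  simp_rw [nsmul_eq_mul, zsmul_eq_mul]
  choose c' c'0 Pp'_le using exp_approx_aux f
  use
    if h : ((f.aroots ℂ).map c').toFinset.Nonempty then ((f.aroots ℂ).map c').toFinset.max' h else 0
  refine ⟨M, ?_⟩
  intro p p_gt prime_p
  obtain ⟨gp', -, h'⟩ := eval_sumIDeriv_of_pos (X ^ (p - 1) * f ^ p) prime_p.pos
  specialize h' 0 (by rw [C_0, sub_zero])
  use f.eval 0 ^ p + p * gp'.eval 0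
  constructor
  · rw [dvd_add_left (dvd_mul_right _ _)]
    contrapose! p_gt with h
    exact Nat.le_of_dvd (Int.natAbs_pos.mpr hf) (Int.natCast_dvd.mp (Int.Prime.dvd_pow' prime_p h))
  constructor
  · have hb := eval_zero_sumIDeriv_bound (X ^ (p - 1) * f ^ p) (M ^ p) (p * (f.natDegree + 1))
      (fun k => by
        rw [coeff_X_pow_mul']
        split_ifs
        · exact coeff_pow_bound f M hM p _
        · simp)
      (by
        have h1 : (X ^ (p - 1) * f ^ p : ℤ[X]).natDegree ≤ (p - 1) + p * f.natDegree :=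
          natDegree_mul_le.trans (by rw [natDegree_X_pow, natDegree_pow])
        have := prime_p.pos
        rw [mul_add]
        omega)
    rw [h'] at hb
    refine le_trans ?_ hb
    have hfac : (p - 1)! • eval 0 (f ^ p) + p ! • eval 0 gp'
        = ((p - 1)! : ℤ) * (eval 0 f ^ p + p * eval 0 gp') := by
      rw [← Nat.mul_factorial_pred prime_p.ne_zero]
      simp
      ring
    rw [hfac, Int.natAbs_mul, Int.natAbs_natCast]
    exact Nat.le_mul_of_pos_left _ (Nat.factorial_pos _)
  obtain ⟨gp, gp'_le, h⟩ := aeval_sumIDeriv ℂ (X ^ (p - 1) * f ^ p) p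
  refine ⟨gp, ?_, ?_⟩
  · refine gp'_le.trans ((tsub_le_tsub_right natDegree_mul_le p).trans ?_)
    rw [natDegree_X_pow, natDegree_pow, tsub_add_eq_add_tsub prime_p.one_le, tsub_right_comm,
      add_tsub_cancel_left]
  intro r hr
  specialize h r _
  · rw [mem_roots'] at hr
    rw [Polynomial.map_mul, f.map_pow]
    exact dvd_mul_of_dvd_right (pow_dvd_pow_of_dvd (dvd_iff_isRoot.mpr hr.2) _) _
  rw [nsmul_eq_mul] at h
  have :
      (↑(eval 0 f ^ p + p * eval 0 gp') * cexp r - p * (aeval r) gp) * (p - 1)! =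
      ((eval 0 f ^ p * cexp r) * (p - 1)! +
        ↑(p * (p - 1)!) * (eval 0 gp' * cexp r - (aeval r) gp)) := by
    push_cast; ring
  rw [le_div_iff₀ (Nat.cast_pos.mpr (Nat.factorial_pos _) : (0 : ℝ) < _), ← norm_natCast,
    ← norm_mul, this, Nat.mul_factorial_pred prime_p.ne_zero, mul_sub, ← h]
  have :
      ↑(eval 0 f) ^ p * cexp r * ↑(p - 1)! +
        (↑p ! * (↑(eval 0 gp') * cexp r) - (aeval r) (sumIDeriv (X ^ (p - 1) * f ^ p))) =
      ((p - 1)! • ↑(eval 0 (f ^ p)) + p ! • ↑(eval 0 gp') : ℤ) * cexp r -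
        (aeval r) (sumIDeriv (X ^ (p - 1) * f ^ p)) := by
    simp; ring
  rw [this, ← h', mul_comm, ← eq_intCast (algebraMap ℤ ℂ),
    ← aeval_algebraMap_apply_eq_algebraMap_eval, map_zero,
    aeval_sumIDeriv_eq_eval, aeval_sumIDeriv_eq_eval, ← PP]
  refine (Pp'_le r p prime_p.ne_zero).trans (pow_le_pow_left₀ (c'0 r) ?_ _)
  have aux : c' r ∈ (Multiset.map c' (f.aroots ℂ)).toFinset := by
    simpa only [Multiset.mem_toFinset] using Multiset.mem_map_of_mem _ hr
  have h : ((f.aroots ℂ).map c').toFinset.Nonempty := ⟨c' r, aux⟩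
  simpa only [h, ↓reduceDIte] using Finset.le_max' _ _ aux


theorem isIntegral_smul_aeval {K : Type*} [Field K] [CharZero K] (f g : ℤ[X]) (β : K)
    (hβ : aeval β f = 0) (m : ℕ) (hm : g.natDegree ≤ m) :
    IsIntegral ℤ ((f.leadingCoeff : K) ^ m * aeval β g) := by
  have hint : IsIntegral ℤ ((f.leadingCoeff : K) * β) := by
    have := isIntegral_leadingCoeff_smul f β hβ
    simpa [zsmul_eq_mul] using this
  rw [aeval_eq_sum_range' (Nat.lt_succ_of_le hm), Finset.mul_sum]
  refine IsIntegral.sum _ fun i hi => ?_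
  have hi' : i ≤ m := by simpa [Nat.lt_succ_iff] using hi
  have : (f.leadingCoeff : K) ^ m * g.coeff i • β ^ i
      = ((f.leadingCoeff ^ (m - i) * g.coeff i : ℤ) : K) * ((f.leadingCoeff : K) * β) ^ i := by
    rw [zsmul_eq_mul, mul_pow]
    obtain ⟨j, rfl⟩ := Nat.exists_eq_add_of_le hi'
    rw [Nat.add_sub_cancel_left, pow_add]
    push_cast
    ring
  rw [this]
  exact (isIntegral_algebraMap (R := ℤ) (A := K)).mul (hint.pow i)

theorem exists_int_eq {K : Type*} [Field K] [NumberField K] [IsGalois ℚ K]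
    (x : K) (hx : IsIntegral ℤ x) (hfix : ∀ τ : K ≃ₐ[ℚ] K, τ x = x) : ∃ z : ℤ, (z : K) = x := by
  have h1 : x ∈ (⊥ : IntermediateField ℚ K) := (IsGalois.mem_bot_iff_fixed x).2 hfix
  obtain ⟨r, rfl⟩ := IntermediateField.mem_bot.1 h1
  have h2 : IsIntegral ℤ r := (isIntegral_algebraMap_iff (algebraMap ℚ K).injective).1 hx
  obtain ⟨z, rfl⟩ := IsIntegrallyClosed.isIntegral_iff.1 h2
  exact ⟨z, by simp⟩

theorem exists_int_sum {K : Type*} [Field K] [NumberField K] [IsGalois ℚ K]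
    {I : Type*} [Fintype I] [DecidableEq K] (e : I → K) (f : ℤ[X])
    (hroot : ∀ i, e i ≠ 0 → aeval (e i) f = 0) (c : I → ℤ)
    (hsym : ∀ τ : K ≃ₐ[ℚ] K, ∃ π : Equiv.Perm I, (∀ i, e (π i) = τ (e i)) ∧ ∀ i, c (π i) = c i)
    (g : ℤ[X]) (m : ℕ) (hm : g.natDegree ≤ m) :
    ∃ z : ℤ, (z : K) = (f.leadingCoeff : K) ^ m *
      ∑ i, if e i = 0 then 0 else (c i : K) * aeval (e i) g := by
  refine exists_int_eq _ ?_ ?_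
  · rw [Finset.mul_sum]
    refine IsIntegral.sum _ fun i _ => ?_
    split_ifs with h
    · simpa using isIntegral_zero
    · rw [mul_left_comm]
      exact (isIntegral_algebraMap (R := ℤ) (A := K)).mul
        (isIntegral_smul_aeval f g _ (hroot i h) m hm)
  · intro τ
    obtain ⟨π, h1, h2⟩ := hsym τ
    rw [map_mul, map_pow, map_intCast, map_sum]
    congr 1
    refine Eq.symm ?_
    rw [← Equiv.sum_comp π]
    refine Finset.sum_congr rfl fun i _ => ?_
    rw [h1, h2]
    simp only [map_eq_zero, apply_ite τ, map_zero, map_mul, map_intCast]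
    congr 2
    have := Polynomial.aeval_algHom_apply (τ.toAlgHom.restrictScalars ℤ) (e i) g
    simpa using this

theorem exists_poly {K : Type*} [Field K] [NumberField K] {I : Type*} [Fintype I] (e : I → K) :
    ∃ f : ℤ[X], f.eval 0 ≠ 0 ∧ ∀ i, e i ≠ 0 → aeval (e i) f = 0 := by
  classical
  have h : ∀ i, ∃ f : ℤ[X], f.eval 0 ≠ 0 ∧ (e i ≠ 0 → aeval (e i) f = 0) := by
    intro i
    by_cases hi : e i = 0
    · exact ⟨1, by simp, fun h => absurd hi h⟩
    · have halg : IsAlgebraic ℤ (e i) :=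
        (IsFractionRing.isAlgebraic_iff ℤ ℚ K).2 (Algebra.IsAlgebraic.isAlgebraic (e i))
      obtain ⟨f, h1, h2⟩ := halg.exists_nonzero_coeff_and_aeval_eq_zero
        (mem_nonZeroDivisors_of_ne_zero hi)
      exact ⟨f, by rwa [← coeff_zero_eq_eval_zero], fun _ => h2⟩
  choose F h1 h2 using h
  refine ⟨∏ i, F i, ?_, fun i hi => ?_⟩
  · rw [eval_prod]
    exact Finset.prod_ne_zero_iff.2 fun i _ => h1 i
  · rw [map_prod]
    exact Finset.prod_eq_zero (Finset.mem_univ i) (h2 i hi)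

theorem main_ineq {K : Type*} [Field K] [NumberField K] [IsGalois ℚ K] [DecidableEq K]
    (emb : K →+* ℂ) {I : Type*} [Fintype I] (e : I → K) :
    ∃ (C : ℝ) (E : ℕ) (l₀ : ℕ), 1 ≤ C ∧ ∀ l > l₀, l.Prime → ∀ c : I → ℤ,
      (∀ τ : K ≃ₐ[ℚ] K, ∃ π : Equiv.Perm I, (∀ i, e (π i) = τ (e i)) ∧ ∀ i, c (π i) = c i) →
      ¬ (l : ℤ) ∣ (∑ i, if e i = 0 then c i else 0) →
      1 ≤ C ^ l * (l * E)! * ‖∑ i, (c i : ℂ) * exp (emb (e i))‖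
        + (∑ i, |(c i : ℝ)|) * (C ^ l / (l - 1)!) := by
  obtain ⟨f, hf0, hroot⟩ := exists_poly e
  obtain ⟨c₀, M, happ⟩ := exp_approx f hf0
  have hfne : f ≠ 0 := by rintro rfl; simp at hf0
  set a : ℤ := f.leadingCoeff with ha
  have ha0 : a ≠ 0 := leadingCoeff_ne_zero.2 hfne
  have ha1 : (1 : ℝ) ≤ |(a : ℝ)| := by exact_mod_cast Int.one_le_abs ha0
  set A : ℝ := |(a : ℝ)| ^ f.natDegree with hA
  have hA1 : 1 ≤ A := one_le_pow₀ ha1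
  refine ⟨A * (max |c₀| (max M 1)), f.natDegree + 1, (eval 0 f).natAbs + a.natAbs, ?_, ?_⟩
  · exact one_le_mul_of_one_le_of_one_le hA1 ((le_max_right _ _).trans (le_max_right _ _))
  intro l hl hlp c hsym hndvd
  obtain ⟨n, hn1, hn2, g, hg1, hg2⟩ := happ l (by omega) hlp
  have hgd : g.natDegree ≤ l * f.natDegree := by omega
  obtain ⟨z, hz⟩ := exists_int_sum e f hroot c hsym g _ hgd
  set b : ℤ := ∑ i, if e i = 0 then c i else 0 with hb
  -- the nonzero integer
  have hZ : (a ^ (l * f.natDegree) * (n * b) + l * z : ℤ) ≠ 0 := by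
    intro h0
    have hd : (l : ℤ) ∣ a ^ (l * f.natDegree) * (n * b) := by
      refine (dvd_add_left (dvd_mul_right (l : ℤ) z)).1 ?_
      rw [h0]; exact dvd_zero _
    have hlp' : Prime (l : ℤ) := Nat.prime_iff_prime_int.1 hlp
    rcases hlp'.dvd_or_dvd hd with h | h
    · have h := hlp'.dvd_of_dvd_pow h
      have := Nat.le_of_dvd (Int.natAbs_pos.2 ha0) (Int.natCast_dvd.1 h)
      omega
    · rcases hlp'.dvd_or_dvd h with h | h
      · exact hn1 h
      · exact hndvd h
  have hZ1 : (1 : ℝ) ≤ ‖((a ^ (l * f.natDegree) * (n * b) + l * z : ℤ) : ℂ)‖ := by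
    rw [Complex.norm_intCast]
    exact_mod_cast Int.one_le_abs hZ
  have hzC : (z : ℂ) = (a : ℂ) ^ (l * f.natDegree) *
      ∑ i, if e i = 0 then 0 else (c i : ℂ) * aeval (emb (e i)) g := by
    have := congrArg emb hz
    rw [map_intCast, map_mul, map_pow, map_intCast, map_sum] at this
    rw [this]
    congr 1
    refine Finset.sum_congr rfl fun i _ => ?_
    rw [apply_ite emb, map_zero, map_mul, map_intCast]
    congr 2
    have := Polynomial.aeval_algHom_apply (emb.toIntAlgHom) (e i) g
    simpa using this.symm
  have hbC : (b : ℂ) = ∑ i, if e i = 0 then (c i : ℂ) else 0 := by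
    rw [hb]; push_cast
    rfl
  have hid : ((a ^ (l * f.natDegree) * (n * b) + l * z : ℤ) : ℂ)
      = (a : ℂ) ^ (l * f.natDegree) * ((n : ℂ) * ∑ i, (c i : ℂ) * exp (emb (e i))
        - ∑ i, if e i = 0 then 0 else
          (c i : ℂ) * (n • exp (emb (e i)) - l • aeval (emb (e i)) g)) := by
    push_cast
    rw [hzC, mul_left_comm (l : ℂ), ← mul_add, hbC]
    congr 1
    rw [Finset.mul_sum, Finset.mul_sum, Finset.mul_sum, ← Finset.sum_add_distrib,
      ← Finset.sum_sub_distrib]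
    refine Finset.sum_congr rfl fun i _ => ?_
    split_ifs with h
    · simp [h]
    · simp only [zsmul_eq_mul, nsmul_eq_mul]; ring
  rw [hid, norm_mul, norm_pow, Complex.norm_intCast, mul_comm l, pow_mul, ← hA] at hZ1
  set m := max |c₀| (max (M : ℝ) 1) with hm
  have hm1 : 1 ≤ m := (le_max_right _ _).trans (le_max_right _ _)
  have hmM : (M : ℝ) ≤ m := (le_max_left _ _).trans (le_max_right _ _)
  have hmc : |c₀| ≤ m := le_max_left _ _
  have hfac : (0 : ℝ) < (l - 1)! := by exact_mod_cast Nat.factorial_pos _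
  have herr : ‖∑ i, if e i = 0 then 0 else
          (c i : ℂ) * (n • exp (emb (e i)) - l • aeval (emb (e i)) g)‖
      ≤ (∑ i, |(c i : ℝ)|) * (m ^ l / (l - 1)!) := by
    rw [Finset.sum_mul]
    refine (norm_sum_le _ _).trans (Finset.sum_le_sum fun i _ => ?_)
    split_ifs with h
    · rw [norm_zero]; positivity
    · rw [norm_mul, Complex.norm_intCast]
      refine mul_le_mul_of_nonneg_left ?_ (abs_nonneg _)
      refine (hg2 (r := emb (e i)) ?_).trans ?_
      · rw [mem_aroots]
        refine ⟨hfne, ?_⟩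
        have := Polynomial.aeval_algHom_apply (emb.toIntAlgHom) (e i) f
        rw [hroot i h, map_zero] at this
        simpa using this
      · refine div_le_div_of_nonneg_right ?_ hfac.le
        calc c₀ ^ l ≤ |c₀ ^ l| := le_abs_self _
          _ = |c₀| ^ l := abs_pow _ _
          _ ≤ m ^ l := by gcongr
  have hnb : ‖(n : ℂ)‖ ≤ (l * (f.natDegree + 1))! * m ^ l := by
    rw [Complex.norm_intCast]
    have h1 : |(n : ℝ)| ≤ (l * (f.natDegree + 1))! * (M : ℝ) ^ l := by
      have : (n.natAbs : ℝ) ≤ ((l * (f.natDegree + 1))! * M ^ l : ℕ) := by exact_mod_cast hn2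
      rw [Nat.cast_natAbs] at this
      push_cast at this
      exact this
    refine h1.trans ?_
    gcongr
  calc (1 : ℝ) ≤ _ := hZ1
    _ ≤ A ^ l * (‖(n : ℂ)‖ * ‖∑ i, (c i : ℂ) * exp (emb (e i))‖
          + (∑ i, |(c i : ℝ)|) * (m ^ l / (l - 1)!)) := by
        refine mul_le_mul_of_nonneg_left ?_ (by positivity)
        refine (norm_sub_le _ _).trans ?_
        rw [norm_mul]
        gcongr
    _ ≤ A ^ l * ((l * (f.natDegree + 1))! * m ^ l * ‖∑ i, (c i : ℂ) * exp (emb (e i))‖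
          + (∑ i, |(c i : ℝ)|) * (m ^ l / (l - 1)!)) := by gcongr
    _ = _ := by rw [mul_pow]; ring


theorem factorial_pow_le (L a : ℕ) : (L !) ^ a ≤ (a * L)! := by
  induction a with
  | zero => simp
  | succ a ih =>
    rw [pow_succ, add_mul, one_mul]
    refine (Nat.mul_le_mul_right _ ih).trans ?_
    exact Nat.le_of_dvd (Nat.factorial_pos _) (Nat.factorial_mul_factorial_dvd_factorial_add _ _)

theorem factorial_mul_le (L k : ℕ) :
    ((k * L)! : ℝ) ≤ (((k : ℝ) * Real.exp 1) ^ k) ^ L * (L ! : ℝ) ^ k := by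
  have h1 : ((k * L)! : ℝ) ≤ ((k : ℝ) * L) ^ (k * L) := by
    exact_mod_cast Nat.factorial_le_pow (k * L)
  have h2 : (L : ℝ) ^ L ≤ Real.exp 1 ^ L * L ! := by
    have := Real.pow_div_factorial_le_exp (L : ℝ) (by positivity) L
    rw [div_le_iff₀ (by positivity)] at this
    rwa [← Real.exp_nat_mul, mul_one]
  calc _ ≤ _ := h1
    _ = (k : ℝ) ^ (k * L) * ((L : ℝ) ^ L) ^ k := by rw [mul_pow, ← pow_mul, mul_comm L k]
    _ ≤ (k : ℝ) ^ (k * L) * (Real.exp 1 ^ L * L !) ^ k := by gcongr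
    _ = _ := by ring

theorem eventually_pow_lt_factorial (A C : ℝ) :
    ∀ᶠ L : ℕ in Filter.atTop, A * C ^ L < (L ! : ℝ) := by
  have h := (FloorSemiring.tendsto_pow_div_factorial_atTop C).const_mul A
  rw [mul_zero] at h
  filter_upwards [h.eventually (gt_mem_nhds zero_lt_one)] with L hL
  have : (0 : ℝ) < L ! := by positivity
  rw [← mul_div_assoc, div_lt_one this] at hL
  exact hL

theorem choose_prime (A C : ℝ) (hA : 1 ≤ A) (hC : 1 ≤ C) (E N l₀ : ℕ) :
    ∃ M Q : ℕ, ∀ q ≥ Q, ∃ l > l₀, l.Prime ∧ 2 * A * (q : ℝ) ^ N * C ^ l < (l - 1)! ∧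
      A * (C ^ l * (l * E)!) ≤ (q : ℝ) ^ M := by
  set a := N + 1 with ha
  set k := 2 * a * E with hk
  set D : ℝ := C ^ (2 * a) * ((k : ℝ) * Real.exp 1) ^ k * 2 ^ k with hD
  obtain ⟨L₀, hL₀⟩ := Filter.eventually_atTop.1
    ((eventually_pow_lt_factorial (2 * A) (C ^ (2 * a))).and
      ((eventually_pow_lt_factorial A (D * 2)).and (Filter.eventually_ge_atTop (l₀ + 1))))
  refine ⟨k + 1, (L₀)!, fun q hq => ?_⟩
  have hex : ∃ L : ℕ, q < L ! := by
    obtain ⟨L, hL⟩ := Filter.Eventually.exists (eventually_pow_lt_factorial q 1)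
    exact ⟨L, by simpa using hL⟩
  classical
  obtain ⟨L, hL1, hL2⟩ : ∃ L, q < L ! ∧ ∀ L' < L, L' ! ≤ q :=
    ⟨Nat.find hex, Nat.find_spec hex, fun L' h => not_lt.1 (Nat.find_min hex h)⟩
  have hLL : L₀ ≤ L := by
    by_contra! h
    exact absurd (hq.le.trans hL1.le) (by
      have := Nat.factorial_le h.le
      omega)
  obtain ⟨h1, h2, h3⟩ := hL₀ L hLL
  have hLpos : 0 < L := by omega
  have hLq : (L ! : ℝ) ≤ 2 ^ L * q := by
    have e1 := Nat.mul_factorial_pred hLpos.ne'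
    have e2 := hL2 (L - 1) (by omega)
    have e3 : L ≤ 2 ^ L := Nat.lt_two_pow_self.le
    rw [← e1]
    exact_mod_cast Nat.mul_le_mul e3 e2
  obtain ⟨l, hlp, hl1, hl2⟩ := Nat.exists_prime_lt_and_le_two_mul (a * L) (by positivity)
  have haL : L ≤ a * L := Nat.le_mul_of_pos_left _ (by omega)
  have hCl : C ^ l ≤ (C ^ (2 * a)) ^ L := by
    rw [← pow_mul]
    exact pow_le_pow_right₀ hC (by rw [mul_assoc]; exact hl2)
  refine ⟨l, by omega, hlp, ?_, ?_⟩
  · have e1 : ((L ! : ℝ)) ^ a ≤ (l - 1)! := by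
      exact_mod_cast (factorial_pow_le L a).trans (Nat.factorial_le (by omega))
    calc 2 * A * (q : ℝ) ^ N * C ^ l ≤ 2 * A * (L ! : ℝ) ^ N * (C ^ (2 * a)) ^ L := by
          gcongr
      _ = (L ! : ℝ) ^ N * (2 * A * (C ^ (2 * a)) ^ L) := by ring
      _ < (L ! : ℝ) ^ N * L ! := by
          refine mul_lt_mul_of_pos_left h1 (by positivity)
      _ = (L ! : ℝ) ^ a := by rw [ha, pow_succ]
      _ ≤ _ := e1
  · have e1 : ((l * E)! : ℝ) ≤ (k * L)! := by
      have : l * E ≤ k * L := by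
        calc l * E ≤ (2 * (a * L)) * E := Nat.mul_le_mul_right _ hl2
          _ = k * L := by rw [hk]; ring
      exact_mod_cast Nat.factorial_le this
    have e2 : A * D ^ L ≤ q := by
      have e3 : A * D ^ L * 2 ^ L ≤ q * 2 ^ L := by
        calc A * D ^ L * 2 ^ L = A * (D * 2) ^ L := by rw [mul_pow]; ring
          _ ≤ L ! := h2.le
          _ ≤ _ := by rw [mul_comm]; exact hLq
      exact le_of_mul_le_mul_right e3 (by positivity)
    calc A * (C ^ l * (l * E)!) ≤ A * ((C ^ (2 * a)) ^ L * (k * L)!) := by gcongr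
      _ ≤ A * ((C ^ (2 * a)) ^ L * ((((k : ℝ) * Real.exp 1) ^ k) ^ L * (L ! : ℝ) ^ k)) := by
          gcongr
          exact factorial_mul_le L k
      _ ≤ A * ((C ^ (2 * a)) ^ L * ((((k : ℝ) * Real.exp 1) ^ k) ^ L * (2 ^ L * q : ℝ) ^ k)) := by
          gcongr
      _ = A * D ^ L * (q : ℝ) ^ k := by
          rw [hD]; simp only [mul_pow, ← pow_mul]; ring
      _ ≤ q * (q : ℝ) ^ k := by gcongr
      _ = _ := by rw [pow_succ']


section final

variable {K : Type*} [Field K] [NumberField K]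

instance instDecGal : DecidableEq (K ≃ₐ[ℚ] K) := Classical.decEq _

/-- The exponents occurring in the expansion of the conjugate product. -/
def ex (y : K) (s : (K ≃ₐ[ℚ] K) → SignType) : K := ∑ τ, (((s τ : ℤ)) : K) * τ y

/-- The coefficients occurring in the expansion of the conjugate product. -/
def co (P q : ℤ) (s : (K ≃ₐ[ℚ] K) → SignType) : ℤ := ∏ τ, if s τ = 0 then -2 * P else q

/-- Action of the Galois group on index functions. -/
def act (r : K ≃ₐ[ℚ] K) : Equiv.Perm ((K ≃ₐ[ℚ] K) → SignType) :=
  Equiv.arrowCongr (Equiv.mulLeft r) (Equiv.refl _)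

theorem act_apply (r : K ≃ₐ[ℚ] K) (s : (K ≃ₐ[ℚ] K) → SignType) (τ : K ≃ₐ[ℚ] K) :
    act r s τ = s (r⁻¹ * τ) := rfl

theorem ex_act (y : K) (r : K ≃ₐ[ℚ] K) (s : (K ≃ₐ[ℚ] K) → SignType) :
    ex y (act r s) = r (ex y s) := by
  unfold ex
  rw [map_sum, ← Equiv.sum_comp (Equiv.mulLeft r)]
  refine Finset.sum_congr rfl fun τ _ => ?_
  rw [act_apply, map_mul, map_intCast]
  simp

theorem co_act (P q : ℤ) (r : K ≃ₐ[ℚ] K) (s : (K ≃ₐ[ℚ] K) → SignType) :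
    co P q (act r s) = co P q s := by
  unfold co
  rw [← Equiv.prod_comp (Equiv.mulLeft r)]
  refine Finset.prod_congr rfl fun τ _ => ?_
  rw [act_apply]
  simp

theorem sum_co_exp (emb : K →+* ℂ) (y : K) (P q : ℤ) :
    ∑ s, (co P q s : ℂ) * exp (emb (ex y s)) =
      ∏ τ : K ≃ₐ[ℚ] K, ((q : ℂ) * exp (emb (τ y)) + q * exp (-emb (τ y)) - 2 * P) := by
  classical
  have h : ∀ τ : K ≃ₐ[ℚ] K, (q : ℂ) * exp (emb (τ y)) + q * exp (-emb (τ y)) - 2 * P =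
      ∑ t ∈ (Finset.univ : Finset SignType),
        ((if t = 0 then -2 * P else q : ℤ) : ℂ) * exp (((t : ℤ) : ℂ) * emb (τ y)) := by
    intro τ
    rw [show (Finset.univ : Finset SignType) = {0, -1, 1} from rfl,
      Finset.sum_insert (by decide), Finset.sum_insert (by decide), Finset.sum_singleton]
    simp
    ring
  simp_rw [h]
  rw [Finset.prod_univ_sum, Fintype.piFinset_univ]
  refine Finset.sum_congr rfl fun s _ => ?_
  rw [Finset.prod_mul_distrib, ← Complex.exp_sum]
  unfold ex co
  simp only [map_sum, map_mul, map_intCast, Int.cast_prod]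

theorem exists_sigma (emb : K →+* ℂ) (y : K) (hy : y ≠ 0) :
    ∃ s₀ : (K ≃ₐ[ℚ] K) → SignType, ∀ s, ex y s = ex y s₀ → ∀ τ, s τ ≠ 0 := by
  classical
  obtain ⟨s₀, hs₀⟩ := Finite.exists_max
    (fun s : (K ≃ₐ[ℚ] K) → SignType => ‖emb (ex y s)‖)
  refine ⟨s₀, fun s hs τ hτ => ?_⟩
  have hupd : ∀ t : SignType, ex y (Function.update s τ t) = ex y s + ((t : ℤ) : K) * τ y := by
    intro t
    unfold ex
    rw [← Finset.add_sum_erase _ _ (Finset.mem_univ τ),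
      ← Finset.add_sum_erase (a := τ) _ (fun τ => (((s τ : ℤ)) : K) * τ y) (Finset.mem_univ τ)]
    have : ∀ x ∈ Finset.univ.erase τ, (((Function.update s τ t x : SignType) : ℤ) : K) * x y
        = ((s x : ℤ) : K) * x y := by
      intro x hx
      rw [Function.update_of_ne (Finset.ne_of_mem_erase hx)]
    rw [Finset.sum_congr rfl this]
    simp [hτ]
    ring
  have h1 := hs₀ (Function.update s τ 1)
  have h2 := hs₀ (Function.update s τ (-1))
  simp only [hupd, ← hs] at h1 h2
  set u := emb (ex y s)
  set v := emb (τ y) with hv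
  have hv0 : 0 < ‖v‖ := by
    rw [norm_pos_iff, hv]
    simpa using hy
  have h1' : ‖u + v‖ ≤ ‖u‖ := by simpa using h1
  have h2' : ‖u - v‖ ≤ ‖u‖ := by simpa [sub_eq_add_neg] using h2
  have := parallelogram_law_with_norm ℝ u v
  nlinarith [norm_nonneg (u + v), norm_nonneg (u - v), norm_nonneg u]

/-- The exponents after multiplication by the orbit sum of `-σ`. -/
def ex' (y σ : K) (i : ((K ≃ₐ[ℚ] K) → SignType) × (K ≃ₐ[ℚ] K)) : K := ex y i.1 - i.2 σ

theorem sym' (y σ : K) (P q : ℤ) (r : K ≃ₐ[ℚ] K) :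
    ∃ π : Equiv.Perm (((K ≃ₐ[ℚ] K) → SignType) × (K ≃ₐ[ℚ] K)),
      (∀ i, ex' y σ (π i) = r (ex' y σ i)) ∧ ∀ i, co P q (π i).1 = co P q i.1 := by
  refine ⟨Equiv.prodCongr (act r) (Equiv.mulLeft r), fun i => ?_, fun i => ?_⟩
  · simp [ex', ex_act]
  · simp [co_act]

theorem const' [DecidableEq K] (y σ : K) (P q : ℤ) :
    (∑ i : ((K ≃ₐ[ℚ] K) → SignType) × (K ≃ₐ[ℚ] K), if ex' y σ i = 0 then co P q i.1 else 0)
      = Fintype.card (K ≃ₐ[ℚ] K) * ∑ s, if ex y s = σ then co P q s else 0 := by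
  rw [Fintype.sum_prod_type_right]
  have : ∀ r : K ≃ₐ[ℚ] K, (∑ s, if ex' y σ (s, r) = 0 then co P q s else 0)
      = ∑ s, if ex y s = σ then co P q s else 0 := by
    intro r
    rw [← Equiv.sum_comp (act r)]
    refine Finset.sum_congr rfl fun s _ => ?_
    simp only [ex', ex_act, co_act, sub_eq_zero, EmbeddingLike.apply_eq_iff_eq]
  simp only [this, Finset.sum_const, Finset.card_univ, nsmul_eq_mul]

theorem sum' (emb : K →+* ℂ) (y σ : K) (P q : ℤ) :
    ∑ i : ((K ≃ₐ[ℚ] K) → SignType) × (K ≃ₐ[ℚ] K), (co P q i.1 : ℂ) * exp (emb (ex' y σ i))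
      = (∏ τ : K ≃ₐ[ℚ] K, ((q : ℂ) * exp (emb (τ y)) + q * exp (-emb (τ y)) - 2 * P))
        * ∑ τ : K ≃ₐ[ℚ] K, exp (-emb (τ σ)) := by
  rw [← sum_co_exp, Finset.sum_mul_sum, Fintype.sum_prod_type]
  refine Finset.sum_congr rfl fun s _ => Finset.sum_congr rfl fun r _ => ?_
  rw [mul_assoc, ← Complex.exp_add, ex', map_sub, sub_eq_add_neg]

theorem co_abs_le (P q : ℤ) (B : ℝ) (hq : 0 < q) (hB : 1 ≤ B) (hP : 2 * |(P : ℝ)| ≤ B * q)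
    (s : (K ≃ₐ[ℚ] K) → SignType) :
    |(co P q s : ℝ)| ≤ (B * q) ^ Fintype.card (K ≃ₐ[ℚ] K) := by
  have hq' : (0 : ℝ) < q := by exact_mod_cast hq
  unfold co
  rw [Int.cast_prod, Finset.abs_prod, ← Finset.card_univ, ← Finset.prod_const]
  refine Finset.prod_le_prod (fun _ _ => abs_nonneg _) fun τ _ => ?_
  split_ifs
  · push_cast
    rw [abs_mul]
    simpa using hP
  · rw [abs_of_pos hq']
    nlinarith

theorem prod_bound (emb : K →+* ℂ) (y : K) : ∃ B : ℝ, 0 ≤ B ∧ ∀ (P q : ℤ) (B₀ : ℝ), 0 < q →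
    2 * |(P : ℝ)| ≤ B₀ * q → 1 ≤ B₀ →
    ‖∏ τ : K ≃ₐ[ℚ] K, ((q : ℂ) * exp (emb (τ y)) + q * exp (-emb (τ y)) - 2 * P)‖
      ≤ ‖(q : ℂ) * exp (emb y) + q * exp (-emb y) - 2 * P‖ *
        ((B + B₀) * q) ^ Fintype.card (K ≃ₐ[ℚ] K) := by
  classical
  refine ⟨∑ τ : K ≃ₐ[ℚ] K, (‖exp (emb (τ y))‖ + ‖exp (-emb (τ y))‖),
    Finset.sum_nonneg fun _ _ => by positivity, ?_⟩
  intro P q B₀ hq hP hB₀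
  set B := ∑ τ : K ≃ₐ[ℚ] K, (‖exp (emb (τ y))‖ + ‖exp (-emb (τ y))‖) with hB
  have hB0 : 0 ≤ B := Finset.sum_nonneg fun _ _ => by positivity
  have hq' : (1 : ℝ) ≤ q := by exact_mod_cast hq
  rw [norm_prod, ← Finset.mul_prod_erase _ _ (Finset.mem_univ (1 : K ≃ₐ[ℚ] K))]
  refine mul_le_mul_of_nonneg_left ?_ (norm_nonneg _)
  have hone : 1 ≤ (B + B₀) * q := by nlinarith
  calc _ ≤ ∏ τ ∈ Finset.univ.erase (1 : K ≃ₐ[ℚ] K), ((B + B₀) * q) := by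
        refine Finset.prod_le_prod (fun _ _ => norm_nonneg _) fun τ _ => ?_
        have h1 : ‖exp (emb (τ y))‖ + ‖exp (-emb (τ y))‖ ≤ B :=
          Finset.single_le_sum (f := fun τ : K ≃ₐ[ℚ] K =>
            ‖exp (emb (τ y))‖ + ‖exp (-emb (τ y))‖) (fun _ _ => by positivity)
            (Finset.mem_univ τ)
        have hnq : ‖(q : ℂ)‖ = q := by
          rw [Complex.norm_intCast, abs_of_pos (by linarith)]
        calc _ ≤ ‖(q : ℂ) * exp (emb (τ y))‖ + ‖(q : ℂ) * exp (-emb (τ y))‖ + ‖(2 : ℂ) * P‖ :=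
              (norm_sub_le _ _).trans (add_le_add_left (norm_add_le _ _) _)
          _ = q * (‖exp (emb (τ y))‖ + ‖exp (-emb (τ y))‖) + 2 * |(P : ℝ)| := by
              rw [norm_mul, norm_mul, norm_mul, hnq, Complex.norm_intCast]
              simp
              ring
          _ ≤ q * B + B₀ * q := by gcongr
          _ = _ := by ring
    _ = ((B + B₀) * q) ^ (Finset.univ.erase (1 : K ≃ₐ[ℚ] K)).card := by rw [Finset.prod_const]
    _ ≤ _ := pow_le_pow_right₀ hone (by
        rw [← Finset.card_univ]; exact Finset.card_le_card (Finset.erase_subset _ _))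

/-- The transcendence-type estimate with a fixed shift `σ`. -/
theorem est [IsGalois ℚ K] [DecidableEq K] (emb : K →+* ℂ) (y σ : K) (B₀ : ℝ) (hB₀ : 1 ≤ B₀) :
    ∃ (A C : ℝ) (E : ℕ) (l₀ : ℕ), 1 ≤ A ∧ 1 ≤ C ∧ ∀ l > l₀, l.Prime → ∀ P q : ℤ, 0 < q →
      2 * |(P : ℝ)| ≤ B₀ * q →
      ¬ (l : ℤ) ∣ (Fintype.card (K ≃ₐ[ℚ] K) * ∑ s, if ex y s = σ then co P q s else 0) →
      1 ≤ A * (C ^ l * (l * E)!) * (‖(q : ℂ) * exp (emb y) + q * exp (-emb y) - 2 * P‖ *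
          (q : ℝ) ^ Fintype.card (K ≃ₐ[ℚ] K))
        + A * (q : ℝ) ^ Fintype.card (K ≃ₐ[ℚ] K) * (C ^ l / (l - 1)!) := by
  obtain ⟨C, E, l₀, hC, hmain⟩ := main_ineq emb (ex' y σ)
  obtain ⟨B, hB, hprod⟩ := prod_bound emb y
  set N := Fintype.card (K ≃ₐ[ℚ] K) with hN
  set S := ‖∑ τ : K ≃ₐ[ℚ] K, exp (-emb (τ σ))‖ with hS
  set A₁ := S * (B + B₀) ^ N with hA₁
  set A₂ := (Fintype.card (((K ≃ₐ[ℚ] K) → SignType) × (K ≃ₐ[ℚ] K)) : ℝ) * B₀ ^ N with hA₂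
  have hS0 : 0 ≤ S := norm_nonneg _
  refine ⟨max 1 (max A₁ A₂), C, E, l₀, le_max_left _ _, hC, ?_⟩
  intro l hl hlp P q hq hP hnd
  have hq' : (0 : ℝ) < q := by exact_mod_cast hq
  have h := hmain l hl hlp (fun i => co P q i.1) (sym' y σ P q) (by rw [const']; exact hnd)
  rw [sum', norm_mul, ← hS] at h
  refine h.trans (add_le_add ?_ ?_)
  · calc _ ≤ C ^ l * (l * E)! * (‖(q : ℂ) * exp (emb y) + q * exp (-emb y) - 2 * P‖ *
        ((B + B₀) * q) ^ N * S) := by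
          gcongr
          exact hprod P q B₀ hq hP hB₀
      _ = A₁ * (C ^ l * (l * E)!) * (‖(q : ℂ) * exp (emb y) + q * exp (-emb y) - 2 * P‖ *
          (q : ℝ) ^ N) := by rw [hA₁, mul_pow]; ring
      _ ≤ _ := by
          gcongr
          exact (le_max_left _ _).trans (le_max_right _ _)
  · refine mul_le_mul_of_nonneg_right ?_ (by positivity)
    calc _ ≤ ∑ i : ((K ≃ₐ[ℚ] K) → SignType) × (K ≃ₐ[ℚ] K), (B₀ * q) ^ N :=
          Finset.sum_le_sum fun i _ => co_abs_le P q B₀ hq hB₀ hP i.1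
      _ = A₂ * (q : ℝ) ^ N := by
          rw [Finset.sum_const, Finset.card_univ, nsmul_eq_mul, hA₂, mul_pow]; ring
      _ ≤ _ := by
          gcongr
          exact (le_max_right _ _).trans (le_max_right _ _)

theorem not_dvd_zero [DecidableEq K] (y : K) (P q : ℤ) (l : ℕ) (hlp : l.Prime) (hl2 : 2 < l)
    (hlN : Fintype.card (K ≃ₐ[ℚ] K) < l) (hcop : IsCoprime P q) (hlq : (l : ℤ) ∣ q) :
    ¬ (l : ℤ) ∣ (Fintype.card (K ≃ₐ[ℚ] K) * ∑ s, if ex y s = 0 then co P q s else 0) := by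
  classical
  have hlp' : Prime (l : ℤ) := Nat.prime_iff_prime_int.1 hlp
  intro hd
  rcases hlp'.dvd_or_dvd hd with h | h
  · have := Nat.le_of_dvd Fintype.card_pos (Int.natCast_dvd_natCast.1 h)
    omega
  · rw [← Finset.add_sum_erase _ _ (Finset.mem_univ (0 : (K ≃ₐ[ℚ] K) → SignType))] at h
    have h2 : (l : ℤ) ∣ ∑ s ∈ Finset.univ.erase (0 : (K ≃ₐ[ℚ] K) → SignType),
        if ex y s = 0 then co P q s else 0 := by
      refine Finset.dvd_sum fun s hs => ?_
      split_ifs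
      · have hne := Finset.ne_of_mem_erase hs
        obtain ⟨τ, hτ⟩ := Function.ne_iff.1 hne
        refine hlq.trans ?_
        have : (if s τ = 0 then -2 * P else q) = q := if_neg hτ
        rw [co]
        conv_lhs => rw [← this]
        exact Finset.dvd_prod_of_mem (fun τ => if s τ = 0 then -2 * P else q)
          (Finset.mem_univ τ)
      · exact dvd_zero _
    have h3 := (dvd_add_left h2).1 h
    have h0 : ex y (0 : (K ≃ₐ[ℚ] K) → SignType) = 0 := by simp [ex]
    rw [if_pos h0] at h3
    simp only [co, Pi.zero_apply, if_true, Finset.prod_const] at h3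
    have h4 := hlp'.dvd_of_dvd_pow h3
    rcases hlp'.dvd_or_dvd h4 with h5 | h5
    · have := Nat.le_of_dvd (by norm_num) (Int.natCast_dvd.1 h5)
      simp at this
      omega
    · exact hlp'.not_isUnit (hcop.isUnit_of_dvd' h5 hlq)

theorem not_dvd_sigma [DecidableEq K] (y : K) (s₀ : (K ≃ₐ[ℚ] K) → SignType)
    (hs₀ : ∀ s, ex y s = ex y s₀ → ∀ τ, s τ ≠ 0) (P q : ℤ) (l : ℕ) (hlp : l.Prime)
    (hlN : Fintype.card (K ≃ₐ[ℚ] K) < l)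
    (hlR : Fintype.card ((K ≃ₐ[ℚ] K) → SignType) < l) (hlq : ¬ (l : ℤ) ∣ q) :
    ¬ (l : ℤ) ∣ (Fintype.card (K ≃ₐ[ℚ] K) * ∑ s, if ex y s = ex y s₀ then co P q s else 0) := by
  classical
  have hlp' : Prime (l : ℤ) := Nat.prime_iff_prime_int.1 hlp
  intro hd
  rcases hlp'.dvd_or_dvd hd with h | h
  · have := Nat.le_of_dvd Fintype.card_pos (Int.natCast_dvd_natCast.1 h)
    omega
  · rw [← Finset.sum_filter] at h
    have h1 : ∀ s ∈ Finset.univ.filter (fun s => ex y s = ex y s₀),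
        co P q s = q ^ Fintype.card (K ≃ₐ[ℚ] K) := by
      intro s hs
      have hs' := hs₀ s (Finset.mem_filter.1 hs).2
      simp only [co, hs', if_false, Finset.prod_const, Finset.card_univ]
    rw [Finset.sum_congr rfl h1, Finset.sum_const, nsmul_eq_mul] at h
    rcases hlp'.dvd_or_dvd h with h | h
    · have h2 := Nat.le_of_dvd (Finset.card_pos.2 ⟨s₀, by simp⟩) (Int.natCast_dvd_natCast.1 h)
      have h3 := Finset.card_filter_le Finset.univ (fun s => ex y s = ex y s₀)
      rw [Finset.card_univ] at h3
      omega
    · exact hlq (hlp'.dvd_of_dvd_pow h)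

/-- Main estimate: `2 cosh y` is not too well approximable. -/
theorem measure [IsGalois ℚ K] (emb : K →+* ℂ) (y : K) (hy : y ≠ 0) (B₀ : ℝ) (hB₀ : 1 ≤ B₀) :
    ∃ M Q : ℕ, ∀ P : ℤ, ∀ q : ℕ, Q ≤ q → 2 ≤ q → IsCoprime P (q : ℤ) →
      2 * |(P : ℝ)| ≤ B₀ * q →
      1 ≤ 2 * ((q : ℝ) ^ M * ‖(q : ℂ) * exp (emb y) + q * exp (-emb y) - 2 * P‖) := by
  classical
  obtain ⟨s₀, hs₀⟩ := exists_sigma emb y hy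
  obtain ⟨A₁, C₁, E₁, l₁, hA₁, hC₁, h₁⟩ := est emb y 0 B₀ hB₀
  obtain ⟨A₂, C₂, E₂, l₂, hA₂, hC₂, h₂⟩ := est emb y (ex y s₀) B₀ hB₀
  set N := Fintype.card (K ≃ₐ[ℚ] K) with hN
  set R := Fintype.card ((K ≃ₐ[ℚ] K) → SignType) with hR
  obtain ⟨M, Q, hMQ⟩ := choose_prime (max A₁ A₂) (max C₁ C₂) (hA₁.trans (le_max_left _ _))
    (hC₁.trans (le_max_left _ _)) (max E₁ E₂) N (l₁ + l₂ + N + R + 2)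
  refine ⟨M + N, Q, fun P q hQ hq2 hcop hP => ?_⟩
  obtain ⟨l, hl, hlp, hc1, hc2⟩ := hMQ q hQ
  have hq0 : (0 : ℝ) < q := by positivity
  set T := ‖(q : ℂ) * exp (emb y) + q * exp (-emb y) - 2 * P‖ with hT
  have hT0 : 0 ≤ T := norm_nonneg _
  have key : ∀ (A C : ℝ) (E : ℕ), 1 ≤ A → 1 ≤ C → A ≤ max A₁ A₂ → C ≤ max C₁ C₂ →
      E ≤ max E₁ E₂ →
      1 ≤ A * (C ^ l * (l * E)!) * (T * (q : ℝ) ^ N)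
        + A * (q : ℝ) ^ N * (C ^ l / (l - 1)!) → 1 ≤ 2 * ((q : ℝ) ^ (M + N) * T) := by
    intro A C E hA hC hA' hC' hE' hh
    have hfacE : ((l * E)! : ℝ) ≤ (l * max E₁ E₂)! := by
      exact_mod_cast Nat.factorial_le (Nat.mul_le_mul_left _ hE')
    have e1 : A * (C ^ l * (l * E)!) * (T * (q : ℝ) ^ N) ≤ (q : ℝ) ^ (M + N) * T := by
      calc _ ≤ (max A₁ A₂ * (max C₁ C₂ ^ l * (l * max E₁ E₂)!)) * (T * (q : ℝ) ^ N) := by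
            gcongr
        _ ≤ (q : ℝ) ^ M * (T * (q : ℝ) ^ N) := by gcongr
        _ = _ := by rw [pow_add]; ring
    have e2 : A * (q : ℝ) ^ N * (C ^ l / (l - 1)!) ≤ 1 / 2 := by
      have hf : (0 : ℝ) < (l - 1)! := by positivity
      rw [← mul_div_assoc, div_le_iff₀ hf]
      have : A * (q : ℝ) ^ N * C ^ l ≤ max A₁ A₂ * (q : ℝ) ^ N * max C₁ C₂ ^ l := by gcongr
      linarith
    linarith
  have hqz : (0 : ℤ) < (q : ℤ) := by exact_mod_cast (by omega : 0 < q)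
  by_cases hlq : (l : ℤ) ∣ (q : ℤ)
  · have hh := h₁ l (by omega) hlp P q hqz (by exact_mod_cast hP)
      (not_dvd_zero y P q l hlp (by omega) (by omega) hcop hlq)
    exact key A₁ C₁ E₁ hA₁ hC₁ (le_max_left _ _) (le_max_left _ _) (le_max_left _ _)
      (by simpa using hh)
  · have hh := h₂ l (by omega) hlp P q hqz (by exact_mod_cast hP)
      (not_dvd_sigma y s₀ hs₀ P q l hlp (by omega) (by omega) hlq)
    exact key A₂ C₂ E₂ hA₂ hC₂ (le_max_right _ _) (le_max_right _ _) (le_max_right _ _)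
      (by simpa using hh)

end final

theorem exists_field (y : ℂ) (hy : IsAlgebraic ℚ y) :
    ∃ (K : Type) (_ : Field K) (_ : NumberField K) (_ : IsGalois ℚ K) (emb : K →+* ℂ) (x : K),
      emb x = y := by
  have hint : IsIntegral ℚ y := hy.isIntegral
  let p := minpoly ℚ y
  let L := IntermediateField.adjoin ℚ (p.rootSet ℂ)
  have hsp : p.IsSplittingField ℚ L :=
    IntermediateField.adjoin_rootSet_isSplittingField (IsAlgClosed.splits _)
  have hfd : FiniteDimensional ℚ L := Polynomial.IsSplittingField.finiteDimensional L p
  have hgal : IsGalois ℚ L := IsGalois.of_separable_splitting_field (p := p)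
    (minpoly.irreducible hint).separable
  refine ⟨L, inferInstance, ⟨⟩, hgal, algebraMap L ℂ,
    ⟨y, IntermediateField.subset_adjoin _ _ ?_⟩, rfl⟩
  rw [Polynomial.mem_rootSet]
  exact ⟨minpoly.ne_zero hint, minpoly.aeval ℚ y⟩

theorem exists_coprime_approx (α : ℝ) (h : Liouville α) (n Q : ℕ) :
    ∃ r : ℚ, Q < r.den ∧ |α - r| < 1 / (r.den : ℝ) ^ n := by
  have hirr := h.irrational
  have hev := hirr.eventually_forall_le_dist_cast_rat_of_den_le Q
  obtain ⟨δ, hδ, hδ0⟩ : ∃ δ : ℝ, (∀ r : ℚ, r.den ≤ Q → δ ≤ dist α r) ∧ 0 < δ := by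
    obtain ⟨δ, h1, h2⟩ := ((hev.filter_mono nhdsWithin_le_nhds).and
      (self_mem_nhdsWithin (a := (0 : ℝ)) (s := Set.Ioi 0))).exists
    exact ⟨δ, h1, h2⟩
  obtain ⟨m, hm⟩ := exists_nat_gt (1 / δ)
  obtain ⟨b, hb, a, -, hab⟩ := (Filter.frequently_atTop.1 (h.frequently_exists_num (n + 1)))
    (m + 1)
  have hb1 : (1 : ℝ) ≤ b := by exact_mod_cast (by omega : 1 ≤ b)
  have hrc : (((a : ℚ) / (b : ℚ) : ℚ) : ℝ) = a / b := by push_cast; rfl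
  refine ⟨(a : ℚ) / (b : ℚ), ?_, ?_⟩
  · by_contra! hQ
    have := hδ _ hQ
    rw [hrc, Real.dist_eq] at this
    have h2 : 1 / (b : ℝ) ^ (n + 1) ≤ 1 / b := by
      gcongr
      exact le_self_pow₀ hb1 (by omega)
    have h3 : 1 / (b : ℝ) < δ := by
      rw [div_lt_comm₀ (by linarith) hδ0]
      refine hm.trans_le ?_
      exact_mod_cast (by omega : m ≤ b)
    linarith
  · rw [hrc]
    refine hab.trans_le ?_
    have hden : ((a : ℚ) / (b : ℚ)).den ≤ b := by
      have : (((a : ℚ) / ((b : ℤ) : ℚ)).den : ℤ) ∣ (b : ℤ) := by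
        rw [← Rat.divInt_eq_div]
        exact Rat.den_dvd a b
      exact Nat.le_of_dvd (by omega) (by exact_mod_cast this)
    have hdpos : (0 : ℝ) < ((a : ℚ) / (b : ℚ)).den := by exact_mod_cast Rat.den_pos _
    have hden' : (((a : ℚ) / (b : ℚ)).den : ℝ) ≤ b := by exact_mod_cast hden
    gcongr
    calc _ ≤ (b : ℝ) ^ n := by gcongr
      _ ≤ _ := pow_le_pow_right₀ hb1 (by omega)

end

end LA

theorem liouville_arccosh_transcendental (α : ℝ) (h : Liouville α) (hge : 1 ≤ α) :
    Transcendental ℚ (Real.log (α + Real.sqrt (α ^ 2 - 1))) := by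
  intro halg
  set y : ℝ := Real.log (α + Real.sqrt (α ^ 2 - 1)) with hy
  have hcosh : Real.cosh y = α := Real.cosh_arcosh hge
  have hy0 : y ≠ 0 := by
    intro h0
    rw [h0, Real.cosh_zero] at hcosh
    exact h.irrational ⟨1, by simpa using hcosh⟩
  obtain ⟨K, _, _, _, emb, x, hx⟩ := LA.exists_field (y : ℂ)
    (IsAlgebraic.algHom (Complex.ofRealAm.restrictScalars ℚ) halg)
  have hx0 : x ≠ 0 := by
    rintro rfl
    rw [map_zero] at hx
    exact hy0 (by exact_mod_cast hx.symm)
  obtain ⟨M, Q, hM⟩ := LA.measure emb x hx0 (2 * (α + 1)) (by linarith)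
  obtain ⟨r, hrQ, hr⟩ := LA.exists_coprime_approx α h (M + 4) (Q + 4)
  have hq4 : (4 : ℝ) < r.den := by exact_mod_cast (by omega : 4 < r.den)
  have hrr : (r : ℝ) * r.den = r.num := by exact_mod_cast Rat.mul_den_eq_num r
  have hr1 : |α - r| < 1 := hr.trans_le (by
    rw [div_le_one (by positivity)]
    exact one_le_pow₀ (by linarith))
  have hm := hM r.num r.den (by omega) (by omega) (Int.isCoprime_iff_gcd_eq_one.2 r.reduced) (by
    rw [← hrr, abs_mul, abs_of_pos (by linarith : (0 : ℝ) < r.den)]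
    have h1 : |(r : ℝ)| ≤ α + 1 := by
      rw [abs_lt] at hr1
      rw [abs_le]
      constructor <;> linarith
    nlinarith)
  have hval : ((r.den : ℂ) * Complex.exp (emb x) + r.den * Complex.exp (-emb x) - 2 * r.num)
      = ((2 * r.den * (α - r) : ℝ) : ℂ) := by
    rw [hx]
    have h1 : Complex.exp (y : ℂ) + Complex.exp (-(y : ℂ)) = 2 * (α : ℂ) := by
      rw [← hcosh, Complex.ofReal_cosh, Complex.cosh]
      ring
    have h2 : (r.num : ℂ) = ((r : ℝ) : ℂ) * r.den := by exact_mod_cast hrr.symm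
    rw [h2, ← mul_add, h1]
    push_cast
    ring
  rw [hval, Complex.norm_real, Real.norm_eq_abs, abs_mul,
    abs_of_pos (by linarith : (0 : ℝ) < 2 * r.den)] at hm
  have hd0 : (0 : ℝ) < r.den := by linarith
  rw [lt_div_iff₀ (by positivity)] at hr
  have e : |α - r| * (r.den : ℝ) ^ (M + 4) =
      ((r.den : ℝ) ^ M * (r.den * |α - r|)) * (r.den : ℝ) ^ 3 := by ring
  rw [e] at hr
  set Z := (r.den : ℝ) ^ M * (r.den * |α - r|) with hZ
  have hm' : 1 ≤ 4 * Z := by rw [hZ]; linarith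
  have h64 : (64 : ℝ) < (r.den : ℝ) ^ 3 := by
    calc (64 : ℝ) = 4 ^ 3 := by norm_num
      _ < _ := by gcongr
  nlinarith
end

section
/- If α is a Liouville number with |α| < 1, then artanh α = (1/2)·log((1+α)/(1−α)) is transcendental. -/
namespace LWQuant

noncomputable section Analytic

open scoped Nat
open Complex Polynomial

/-- The function `I(s)` in the Lindemann-Weierstrass proof. -/
def P (f : ℂ[X]) (s : ℂ) :=
  exp s * f.sumIDeriv.eval 0 - f.sumIDeriv.eval s

theorem P_eq_integral_exp_mul_eval (f : ℂ[X]) (s : ℂ) :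
    P f s = exp s * (s * ∫ x in 0..1, exp (-(x • s)) * f.eval (x • s)) := by
  rw [LindemannWeierstrass.integral_exp_mul_eval, mul_add, mul_neg, exp_neg, mul_inv_cancel_left₀ (exp_ne_zero s),
    neg_add_eq_sub, P]

/-- Given a sequence of complex polynomials `fₚ`, a complex constant `s`, and a real constant `c` such
that `|fₚ(xs)| ≤ c ^ p` for all `p ∈ ℕ` and `x ∈ Ioc 0 1`, then there is also a nonnegative
constant bounding the growth.
-/
theorem P_le_aux (f : ℕ → ℂ[X]) (s : ℂ) (c : ℝ)
    (hc : ∀ p : ℕ, ∀ x ∈ Set.Ioc (0 : ℝ) 1, ‖(f p).eval (x • s)‖ ≤ c ^ p) :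
    ∃ c' ≥ 0, ∀ p : ℕ,
      ‖P (f p) s‖ ≤
        Real.exp s.re * (Real.exp ‖s‖ * c' ^ p * ‖s‖) := by
  refine ⟨|c|, abs_nonneg _, fun p => ?_⟩
  rw [P_eq_integral_exp_mul_eval (f p) s, mul_comm s, norm_mul, norm_mul, norm_exp]
  gcongr
  rw [intervalIntegral.integral_of_le zero_le_one, ← mul_one (_ * _)]
  convert! MeasureTheory.norm_setIntegral_le_of_norm_le_const _ _
  · rw [Real.volume_real_Ioc_of_le zero_le_one, sub_zero]
  · rw [Real.volume_Ioc, sub_zero]; exact ENNReal.ofReal_lt_top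
  intro x hx
  rw [norm_mul, norm_exp]
  gcongr
  · simp only [Set.mem_Ioc] at hx
    apply (re_le_norm _).trans
    rw [norm_neg, norm_smul, Real.norm_of_nonneg hx.1.le]
    exact mul_le_of_le_one_left (norm_nonneg _) hx.2
  · rw [← abs_pow]
    exact (hc p x hx).trans (le_abs_self _)

/-- Given a sequence of complex polynomials `fₚ`, a complex constant `s`, and a real constant `c` such
that `|fₚ(xs)| ≤ c ^ p` for all `p ∈ ℕ` and `x ∈ Ioc 0 1`, then there is also a nonnegative
constant bounding the growth.
-/
theorem P_le (f : ℕ → ℂ[X]) (s : ℂ) (c : ℝ)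
    (hc : ∀ p : ℕ, ∀ x ∈ Set.Ioc (0 : ℝ) 1, ‖(f p).eval (x • s)‖ ≤ c ^ p) :
    ∃ c' ≥ 0, ∀ p ≠ 0, ‖P (f p) s‖ ≤ c' ^ p := by
  obtain ⟨c', hc', h'⟩ := P_le_aux f s c hc; clear c hc
  let c₁ := max (Real.exp s.re) 1
  let c₂ := max (Real.exp ‖s‖) 1
  let c₃ := max ‖s‖ 1
  use c₁ * (c₂ * c' * c₃), by positivity
  intro p hp
  refine (h' p).trans ?_
  simp_rw [mul_pow]
  have le_max_one_pow {x : ℝ} : x ≤ max x 1 ^ p :=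
    (max_cases x 1).elim (fun h ↦ h.1.symm ▸ le_self_pow₀ h.2 hp)
      fun h ↦ by rw [h.1, one_pow]; exact h.2.le
  gcongr <;> exact le_max_one_pow

/-- Given a polynomial with integer coefficients `p` and a complex constant `s`, there is a nonnegative
`c` such that for all nonzero `q ∈ ℕ`, `|P(X ^ (q - 1) * p ^ q, s)| ≤ c ^ q`.

Note: Jacobson writes `h(x)` for `x ^ (q - 1) * p(x) ^ q` and `bⱼ` for its coefficients.
-/
theorem exp_polynomial_approx_aux (f : ℤ[X]) (s : ℂ) :
    ∃ c ≥ 0,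
      ∀ p ≠ 0, ‖P (map (algebraMap ℤ ℂ) (X ^ (p - 1) * f ^ p)) s‖ ≤ c ^ p := by
  have : Bornology.IsBounded
      ((fun x : ℝ ↦ max (x * ‖s‖) 1 * ‖aeval (x * s) f‖) '' Set.Ioc 0 1) := by
    have h :
      (fun x : ℝ ↦ max (x * ‖s‖) 1 * ‖aeval (x * s) f‖) '' Set.Ioc 0 1 ⊆
        (fun x : ℝ ↦ max (x * ‖s‖) 1 * ‖aeval (x * s) f‖) '' Set.Icc 0 1 :=
      Set.image_mono Set.Ioc_subset_Icc_self
    refine (IsCompact.image isCompact_Icc ?_).isBounded.subset h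
    fun_prop
  obtain ⟨c, h⟩ := this.exists_norm_le
  simp_rw [Real.norm_eq_abs] at h
  refine P_le _ s c (fun p x hx => ?_)
  specialize h (max (x * ‖s‖) 1 * ‖aeval (x * s) f‖) (Set.mem_image_of_mem _ hx)
  grw [← h]
  simp_rw [Polynomial.map_mul, Polynomial.map_pow, map_X, eval_mul, eval_pow, eval_X, norm_mul,
    Complex.norm_pow, real_smul, norm_mul, norm_real, ← eval₂_eq_eval_map, ← aeval_def, abs_mul,
    abs_norm, mul_pow, Real.norm_of_nonneg hx.1.le]
  refine mul_le_mul_of_nonneg_right ?_ (pow_nonneg (norm_nonneg _) _)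
  rw [← mul_pow, abs_of_nonneg (by positivity), max_def]
  split_ifs with hx1
  · rw [one_pow]
    exact pow_le_one₀ (mul_nonneg hx.1.le (norm_nonneg _)) hx1
  · push Not at hx1
    exact pow_le_pow_right₀ hx1.le (Nat.sub_le _ _)


theorem abs_coeff_mul_le (f g : ℤ[X]) (B : ℤ) (h : ∀ i, |g.coeff i| ≤ B) (i : ℕ) :
    |(f * g).coeff i| ≤ (∑ j ∈ Finset.range (f.natDegree + 1), |f.coeff j|) * B := by
  conv_lhs => rw [f.as_sum_range_C_mul_X_pow]
  rw [Finset.sum_mul, finsetSum_coeff, Finset.sum_mul]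
  refine (Finset.abs_sum_le_sum_abs _ _).trans (Finset.sum_le_sum fun j _ => ?_)
  rw [mul_assoc, coeff_C_mul, abs_mul, coeff_X_pow_mul']
  refine mul_le_mul_of_nonneg_left ?_ (abs_nonneg _)
  split_ifs
  · exact h _
  · simpa using (abs_nonneg _).trans (h 0)

theorem abs_coeff_pow_le (f : ℤ[X]) (p i : ℕ) :
    |(f ^ p).coeff i| ≤ (∑ j ∈ Finset.range (f.natDegree + 1), |f.coeff j|) ^ p := by
  induction p generalizing i with
  | zero => simp only [pow_zero, coeff_one]; split_ifs <;> simp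
  | succ p ih =>
    rw [pow_succ', pow_succ']
    exact abs_coeff_mul_le f _ _ ih i

theorem abs_eval_sumIDeriv_le (f : ℤ[X]) {p : ℕ} (hp : 0 < p) :
    |eval 0 (sumIDeriv (X ^ (p - 1) * f ^ p))| ≤
      (∑ j ∈ Finset.range (f.natDegree + 1), |f.coeff j|) ^ p *
        ((p * (f.natDegree + 1) : ℕ) : ℤ) ^ (p * (f.natDegree + 1)) := by
  set L := (∑ j ∈ Finset.range (f.natDegree + 1), |f.coeff j|) ^ p with hL
  have hdeg : (X ^ (p - 1) * f ^ p).natDegree < p * (f.natDegree + 1) := by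
    refine lt_of_le_of_lt natDegree_mul_le ?_
    rw [natDegree_X_pow, natDegree_pow, mul_add]
    lia
  have hc : ∀ i, |(X ^ (p - 1) * f ^ p).coeff i| ≤ L := by
    intro i
    rw [coeff_X_pow_mul']
    split_ifs
    · exact abs_coeff_pow_le f p _
    · simpa using (abs_nonneg _).trans (abs_coeff_pow_le f p 0)
  have hL0 : 0 ≤ L := (abs_nonneg _).trans (hc 0)
  rw [sumIDeriv_apply_of_lt hdeg, eval_finsetSum]
  generalize X ^ (p - 1) * f ^ p = F at *
  have hM : 0 < p * (f.natDegree + 1) := by positivity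
  generalize p * (f.natDegree + 1) = M at *
  have h1 : ∀ i ∈ Finset.range M, |eval 0 (derivative^[i] F)| ≤ ((M - 1)! : ℕ) * L := by
    intro i hi
    rw [Finset.mem_range] at hi
    rw [← coeff_zero_eq_eval_zero, coeff_iterate_derivative, zero_add, Nat.descFactorial_self,
      nsmul_eq_mul, abs_mul, Nat.abs_cast]
    have : ((i ! : ℕ) : ℤ) ≤ ((M - 1)! : ℕ) := by
      exact_mod_cast Nat.factorial_le (by lia)
    exact mul_le_mul this (hc i) (abs_nonneg _) (by positivity)
  calc _ ≤ ∑ i ∈ Finset.range M, |eval 0 (derivative^[i] F)| := Finset.abs_sum_le_sum_abs _ _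
    _ ≤ ∑ i ∈ Finset.range M, ((M - 1)! : ℕ) * L := Finset.sum_le_sum h1
    _ = ((M ! : ℕ) : ℤ) * L := by
      rw [Finset.sum_const, Finset.card_range, nsmul_eq_mul, ← mul_assoc,
        ← Nat.mul_factorial_pred hM.ne']
      push_cast; ring
    _ ≤ (M : ℤ) ^ M * L := by
      refine mul_le_mul_of_nonneg_right ?_ hL0
      exact_mod_cast Nat.factorial_le_pow M
    _ = _ := mul_comm _ _

theorem exp_polynomial_approx_bound (f : ℤ[X]) (hf : f.eval 0 ≠ 0) :
    ∃ c C : ℝ,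
      ∀ p > (eval 0 f).natAbs, p.Prime →
        ∃ n : ℤ, ¬ ↑p ∣ n ∧ |(n : ℝ)| ≤ C ^ p * (p : ℝ) ^ (p * (f.natDegree + 1)) ∧ ∃ gp : ℤ[X], gp.natDegree ≤ p * f.natDegree - 1 ∧
          ∀ {r : ℂ}, r ∈ f.aroots ℂ →
            ‖n • exp r - p • aeval r gp‖ ≤ c ^ p / (p - 1)! := by
  simp_rw [nsmul_eq_mul, zsmul_eq_mul]
  choose c' c'0 Pp'_le using exp_polynomial_approx_aux f
  use
    if h : ((f.aroots ℂ).map c').toFinset.Nonempty then ((f.aroots ℂ).map c').toFinset.max' h else 0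
  use (∑ j ∈ Finset.range (f.natDegree + 1), |f.coeff j| : ℤ) * ((f.natDegree + 1 : ℕ) : ℝ) ^ (f.natDegree + 1)
  intro p p_gt prime_p
  obtain ⟨gp', -, h'⟩ := eval_sumIDeriv_of_pos (X ^ (p - 1) * f ^ p) prime_p.pos
  specialize h' 0 (by rw [C_0, sub_zero])
  use f.eval 0 ^ p + p * gp'.eval 0
  refine ⟨?_, ?_, ?_⟩
  · rw [dvd_add_left (dvd_mul_right _ _)]
    contrapose! p_gt with h
    exact Nat.le_of_dvd (Int.natAbs_pos.mpr hf) (Int.natCast_dvd.mp (Int.Prime.dvd_pow' prime_p h))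
  · have h2 : eval 0 (sumIDeriv (X ^ (p - 1) * f ^ p)) = (p - 1)! * (f.eval 0 ^ p + p * gp'.eval 0) := by
      rw [h', ← Nat.mul_factorial_pred prime_p.ne_zero]
      simp
      ring
    have h3 := abs_eval_sumIDeriv_le f prime_p.pos
    rw [h2, abs_mul, Nat.abs_cast] at h3
    have h4 : (1 : ℤ) ≤ ((p - 1)! : ℕ) := by exact_mod_cast Nat.factorial_pos _
    have h5 : |f.eval 0 ^ p + p * gp'.eval 0| ≤
      (∑ j ∈ Finset.range (f.natDegree + 1), |f.coeff j|) ^ p * ((p * (f.natDegree + 1) : ℕ) : ℤ) ^ (p * (f.natDegree + 1)) :=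
      le_trans (le_mul_of_one_le_left (abs_nonneg _) h4) h3
    have h6 : ((|f.eval 0 ^ p + p * gp'.eval 0| : ℤ) : ℝ) ≤ (((∑ j ∈ Finset.range (f.natDegree + 1), |f.coeff j|) ^ p * ((p * (f.natDegree + 1) : ℕ) : ℤ) ^ (p * (f.natDegree + 1)) : ℤ) : ℝ) := by
      exact_mod_cast h5
    rw [Int.cast_abs] at h6
    refine h6.trans (le_of_eq ?_)
    push_cast
    rw [mul_pow, mul_pow, ← pow_mul, mul_comm p (f.natDegree + 1)]
    ring
  obtain ⟨gp, gp'_le, h⟩ := aeval_sumIDeriv ℂ (X ^ (p - 1) * f ^ p) p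
  refine ⟨gp, ?_, ?_⟩
  · refine gp'_le.trans ((tsub_le_tsub_right natDegree_mul_le p).trans ?_)
    rw [natDegree_X_pow, natDegree_pow, tsub_add_eq_add_tsub prime_p.one_le, tsub_right_comm,
      add_tsub_cancel_left]
  intro r hr
  specialize h r _
  · rw [mem_roots'] at hr
    rw [Polynomial.map_mul, f.map_pow]
    exact dvd_mul_of_dvd_right (pow_dvd_pow_of_dvd (dvd_iff_isRoot.mpr hr.2) _) _
  rw [nsmul_eq_mul] at h
  have :
      (↑(eval 0 f ^ p + p * eval 0 gp') * cexp r - p * (aeval r) gp) * (p - 1)! =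
      ((eval 0 f ^ p * cexp r) * (p - 1)! +
        ↑(p * (p - 1)!) * (eval 0 gp' * cexp r - (aeval r) gp)) := by
    push_cast; ring
  rw [le_div_iff₀ (Nat.cast_pos.mpr (Nat.factorial_pos _) : (0 : ℝ) < _), ← norm_natCast,
    ← norm_mul, this, Nat.mul_factorial_pred prime_p.ne_zero, mul_sub, ← h]
  have :
      ↑(eval 0 f) ^ p * cexp r * ↑(p - 1)! +
        (↑p ! * (↑(eval 0 gp') * cexp r) - (aeval r) (sumIDeriv (X ^ (p - 1) * f ^ p))) =
      ((p - 1)! • ↑(eval 0 (f ^ p)) + p ! • ↑(eval 0 gp') : ℤ) * cexp r -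
        (aeval r) (sumIDeriv (X ^ (p - 1) * f ^ p)) := by
    simp; ring
  rw [this, ← h', mul_comm, ← eq_intCast (algebraMap ℤ ℂ),
    ← aeval_algebraMap_apply_eq_algebraMap_eval, map_zero,
    aeval_sumIDeriv_eq_eval, aeval_sumIDeriv_eq_eval, ← P]
  refine (Pp'_le r p prime_p.ne_zero).trans (pow_le_pow_left₀ (c'0 r) ?_ _)
  have aux : c' r ∈ (Multiset.map c' (f.aroots ℂ)).toFinset := by
    simpa only [Multiset.mem_toFinset] using Multiset.mem_map_of_mem _ hr
  have h : ((f.aroots ℂ).map c').toFinset.Nonempty := ⟨c' r, aux⟩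
  simpa only [h, ↓reduceDIte] using Finset.le_max' _ _ aux

end Analytic

section Alg

open Polynomial Finset

variable {K : Type*} [Field K] [NumberField K]

/-- The sum of the conjugates of `β` over the set `S` of automorphisms. -/
def bs (β : K) (S : Finset (K ≃ₐ[ℚ] K)) : K := ∑ σ ∈ S, σ β

/-- The coefficient attached to `S`. -/
noncomputable def wt (K : Type*) [Field K] [NumberField K] (x y : ℤ)
    (S : Finset (K ≃ₐ[ℚ] K)) : ℤ :=
  x ^ S.card * (-y) ^ (Fintype.card (K ≃ₐ[ℚ] K) - S.card)

/-- Left translation of finite subsets. -/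
def trans (τ : K ≃ₐ[ℚ] K) : Finset (K ≃ₐ[ℚ] K) ≃ Finset (K ≃ₐ[ℚ] K) :=
  (Equiv.mulLeft τ).finsetCongr

theorem bs_trans (β : K) (τ : K ≃ₐ[ℚ] K) (S) : bs β (trans τ S) = τ (bs β S) := by
  simp [bs, trans, map_sum]

theorem wt_trans (x y : ℤ) (τ : K ≃ₐ[ℚ] K) (S) : wt K x y (trans τ S) = wt K x y S := by
  simp [wt, trans]

theorem exists_coeff [DecidableEq K] {β : K} (hβ : β ≠ 0) {p : ℕ} (hp : p.Prime) (x y : ℤ)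
    (hxy : ¬ ((p : ℤ) ∣ x ∧ (p : ℤ) ∣ y)) :
    ∃ T : Finset (K ≃ₐ[ℚ] K),
      ¬ (p : ℤ) ∣ ∑ S : Finset (K ≃ₐ[ℚ] K) with bs β S = bs β T, wt K x y S := by
  have := Fact.mk hp
  classical
  by_contra! H
  have hprod : (∏ σ : K ≃ₐ[ℚ] K, (AddMonoidAlgebra.single (σ β) (x : ZMod p) +
      AddMonoidAlgebra.single (0 : K) (-y : ZMod p))) ≠ 0 := by
    rw [Finset.prod_ne_zero_iff]
    intro σ _ h0
    have hσ : σ β ≠ 0 := by simpa using hβ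
    apply hxy
    constructor
    · have := congrArg (fun f => f.coeff (σ β)) h0
      simp [hσ.symm] at this
      exact (ZMod.intCast_zmod_eq_zero_iff_dvd _ _).1 this
    · have := congrArg (fun f => f.coeff 0) h0
      simp [hσ] at this
      exact (ZMod.intCast_zmod_eq_zero_iff_dvd _ _).1 this
  apply hprod
  have hexp : (∏ σ : K ≃ₐ[ℚ] K, (AddMonoidAlgebra.single (σ β) (x : ZMod p) +
      AddMonoidAlgebra.single (0 : K) (-y : ZMod p))) =
      ∑ S : Finset (K ≃ₐ[ℚ] K), AddMonoidAlgebra.single (bs β S) ((wt K x y S : ℤ) : ZMod p) := by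
    rw [Finset.prod_add, Finset.powerset_univ]
    refine Finset.sum_congr rfl fun S _ => ?_
    have h1 : ∀ S : Finset (K ≃ₐ[ℚ] K), (∏ σ ∈ S, AddMonoidAlgebra.single (σ β) (x : ZMod p)) =
        AddMonoidAlgebra.single (bs β S) ((x : ZMod p) ^ S.card) := by
      intro S
      induction S using Finset.induction_on with
      | empty => simp [bs, AddMonoidAlgebra.one_def]
      | insert a s ha ih =>
        rw [Finset.prod_insert ha, ih, AddMonoidAlgebra.single_mul_single, Finset.card_insert_of_notMem ha,
          pow_succ', bs, bs, Finset.sum_insert ha]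
    rw [h1, Finset.prod_const, AddMonoidAlgebra.single_pow, AddMonoidAlgebra.single_mul_single]
    simp [wt, Finset.card_sdiff]
  rw [hexp]
  ext γ
  rw [AddMonoidAlgebra.coeff_sum, Finsupp.finsetSum_apply]
  simp only [AddMonoidAlgebra.coeff_single, Finsupp.single_apply, AddMonoidAlgebra.coeff_zero, Finsupp.coe_zero, Pi.zero_apply]
  rw [← Finset.sum_filter]
  by_cases hγ : ∃ T, bs β T = γ
  · obtain ⟨T, rfl⟩ := hγ
    have := (ZMod.intCast_zmod_eq_zero_iff_dvd _ _).2 (H T)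
    push_cast at this
    exact this
  · rw [Finset.filter_false_of_mem]
    · simp
    · intro S _ h
      exact hγ ⟨S, h⟩

theorem const_coeff [DecidableEq K] (β : K) (x y : ℤ) (T : Finset (K ≃ₐ[ℚ] K)) :
    ∑ i : Finset (K ≃ₐ[ℚ] K) × (K ≃ₐ[ℚ] K) with bs β i.1 - i.2 (bs β T) = 0, wt K x y i.1 =
      Fintype.card (K ≃ₐ[ℚ] K) *
        ∑ S : Finset (K ≃ₐ[ℚ] K) with bs β S = bs β T, wt K x y S := by
  rw [Finset.sum_filter, Fintype.sum_prod_type_right]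
  have : ∀ τ : K ≃ₐ[ℚ] K, (∑ S : Finset (K ≃ₐ[ℚ] K),
      if bs β S - τ (bs β T) = 0 then wt K x y S else 0) =
      ∑ S : Finset (K ≃ₐ[ℚ] K) with bs β S = bs β T, wt K x y S := by
    intro τ
    rw [Finset.sum_filter, ← Equiv.sum_comp (trans τ)]
    refine Finset.sum_congr rfl fun S _ => ?_
    simp only [bs_trans, wt_trans, sub_eq_zero, EmbeddingLike.apply_eq_iff_eq]
  simp only [this]
  simp

theorem exists_poly (β : K) : ∃ f : ℤ[X], f.eval 0 ≠ 0 ∧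
    ∀ (S T : Finset (K ≃ₐ[ℚ] K)) (τ : K ≃ₐ[ℚ] K), bs β S - τ (bs β T) ≠ 0 →
      aeval (bs β S - τ (bs β T)) f = 0 := by
  have h : ∀ δ : K, ∃ q : ℤ[X], q.coeff 0 ≠ 0 ∧ (δ ≠ 0 → aeval δ q = 0) := by
    intro δ
    by_cases hδ : δ = 0
    · exact ⟨1, by simp, fun h => absurd hδ h⟩
    · have h1 : IsAlgebraic ℤ δ :=
        (IsFractionRing.isAlgebraic_iff ℤ ℚ K).2 (Algebra.IsAlgebraic.isAlgebraic δ)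
      obtain ⟨q, hq, hq'⟩ := h1.exists_nonzero_coeff_and_aeval_eq_zero (mem_nonZeroDivisors_of_ne_zero hδ)
      exact ⟨q, hq, fun _ => hq'⟩
  choose q hq hq' using h
  refine ⟨∏ i : (Finset (K ≃ₐ[ℚ] K) × Finset (K ≃ₐ[ℚ] K) × (K ≃ₐ[ℚ] K)),
    q (bs β i.1 - i.2.2 (bs β i.2.1)), ?_, ?_⟩
  · rw [eval_prod, Finset.prod_ne_zero_iff]
    intro i _
    rw [← coeff_zero_eq_eval_zero]
    exact hq _
  · intro S T τ h
    rw [map_prod]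
    exact Finset.prod_eq_zero (Finset.mem_univ (S, T, τ)) (hq' _ h)

theorem integral_aeval {δ : K} {f g : ℤ[X]} (hf : aeval δ f = 0) {M : ℕ} (hg : g.natDegree ≤ M) :
    IsIntegral ℤ ((f.leadingCoeff : K) ^ M * aeval δ g) := by
  have h := isIntegral_leadingCoeff_smul f δ hf
  rw [zsmul_eq_mul] at h
  rw [aeval_eq_sum_range, Finset.mul_sum]
  refine IsIntegral.sum _ fun j hj => ?_
  have hj' : j ≤ M := by rw [Finset.mem_range] at hj; lia
  have : (f.leadingCoeff : K) ^ M * g.coeff j • δ ^ j =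
      (((g.coeff j * f.leadingCoeff ^ (M - j) : ℤ)) : K) * (f.leadingCoeff * δ) ^ j := by
    rw [zsmul_eq_mul]
    nth_rw 1 [← Nat.sub_add_cancel hj']
    push_cast
    ring
  rw [this]
  exact (isIntegral_algebraMap (R := ℤ) (A := K)).mul (h.pow j)

theorem exists_int [IsGalois ℚ K] [DecidableEq K] (β : K) (x y : ℤ) (T : Finset (K ≃ₐ[ℚ] K)) {f g : ℤ[X]}
    (hf : ∀ (S T : Finset (K ≃ₐ[ℚ] K)) (τ : K ≃ₐ[ℚ] K), bs β S - τ (bs β T) ≠ 0 →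
      aeval (bs β S - τ (bs β T)) f = 0) {M : ℕ} (hg : g.natDegree ≤ M) :
    ∃ z : ℤ, (f.leadingCoeff : K) ^ M *
      ∑ i : Finset (K ≃ₐ[ℚ] K) × (K ≃ₐ[ℚ] K) with ¬ bs β i.1 - i.2 (bs β T) = 0,
        (wt K x y i.1 : K) * aeval (bs β i.1 - i.2 (bs β T)) g = z := by
  set θ := (f.leadingCoeff : K) ^ M *
      ∑ i : Finset (K ≃ₐ[ℚ] K) × (K ≃ₐ[ℚ] K) with ¬ bs β i.1 - i.2 (bs β T) = 0,
        (wt K x y i.1 : K) * aeval (bs β i.1 - i.2 (bs β T)) g with hθ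
  have hIntg : IsIntegral ℤ θ := by
    rw [hθ, Finset.mul_sum]
    refine IsIntegral.sum _ fun i hi => ?_
    rw [Finset.mem_filter] at hi
    rw [mul_left_comm]
    exact (isIntegral_algebraMap (R := ℤ) (A := K)).mul (integral_aeval (hf _ _ _ hi.2) hg)
  have hfix : ∀ σ : K ≃ₐ[ℚ] K, σ θ = θ := by
    intro σ
    rw [hθ, map_mul, map_pow, map_intCast, map_sum]
    congr 1
    rw [Finset.sum_filter, Finset.sum_filter]
    rw [← Equiv.sum_comp (Equiv.prodCongr (trans σ) (Equiv.mulLeft σ))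
      (fun i : Finset (K ≃ₐ[ℚ] K) × (K ≃ₐ[ℚ] K) => if ¬ bs β i.1 - i.2 (bs β T) = 0 then
        (wt K x y i.1 : K) * aeval (bs β i.1 - i.2 (bs β T)) g else 0)]
    refine Finset.sum_congr rfl fun i _ => ?_
    simp only [Equiv.prodCongr_apply, Prod.map, bs_trans, wt_trans, Equiv.coe_mulLeft, AlgEquiv.mul_apply]
    rw [← map_sub, map_mul, map_intCast]
    have h1 : σ (aeval (bs β i.1 - i.2 (bs β T)) g) = aeval (σ (bs β i.1 - i.2 (bs β T))) g :=
      (aeval_algHom_apply ((σ : K →ₐ[ℚ] K).restrictScalars ℤ) _ g).symm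
    rw [h1]
    simp [sub_eq_zero]
  obtain ⟨r, hr⟩ := (IsGalois.mem_range_algebraMap_iff_fixed (F := ℚ) θ).2 hfix
  rw [← hr] at hIntg
  have h2 : IsIntegral ℤ r := (isIntegral_algebraMap_iff (algebraMap ℚ K).injective).1 hIntg
  obtain ⟨z, hz⟩ := IsIntegrallyClosed.isIntegral_iff.1 h2
  refine ⟨z, ?_⟩
  rw [← hr, ← hz]
  simp

end Alg

section Key

open Polynomial Finset
open scoped Nat

variable {K : Type*} [Field K] [NumberField K]

theorem E_eq (ι : K →+* ℂ) (β : K) (x y : ℤ) (T : Finset (K ≃ₐ[ℚ] K)) :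
    ∑ i : Finset (K ≃ₐ[ℚ] K) × (K ≃ₐ[ℚ] K),
      (wt K x y i.1 : ℂ) * Complex.exp (ι (bs β i.1 - i.2 (bs β T))) =
    (∏ σ : K ≃ₐ[ℚ] K, (x * Complex.exp (ι (σ β)) - y)) *
      ∑ τ : K ≃ₐ[ℚ] K, Complex.exp (-ι (τ (bs β T))) := by
  classical
  have h1 : (∏ σ : K ≃ₐ[ℚ] K, (x * Complex.exp (ι (σ β)) - y)) =
      ∑ S : Finset (K ≃ₐ[ℚ] K), (wt K x y S : ℂ) * Complex.exp (ι (bs β S)) := by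
    simp_rw [sub_eq_add_neg]
    rw [Finset.prod_add, Finset.powerset_univ]
    refine Finset.sum_congr rfl fun S _ => ?_
    rw [Finset.prod_mul_distrib, Finset.prod_const, Finset.prod_const, ← Complex.exp_sum, bs, map_sum,
      wt]
    simp [Finset.card_sdiff]
    ring
  rw [h1, Fintype.sum_prod_type, Finset.sum_mul]
  refine Finset.sum_congr rfl fun S _ => ?_
  rw [Finset.mul_sum]
  refine Finset.sum_congr rfl fun τ _ => ?_
  rw [map_sub, sub_eq_add_neg, Complex.exp_add, mul_assoc]

theorem wt_le {x y : ℤ} {B : ℝ} (hx : |(x : ℝ)| ≤ B) (hy : |(y : ℝ)| ≤ B)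
    (S : Finset (K ≃ₐ[ℚ] K)) : ‖(wt K x y S : ℂ)‖ ≤ B ^ Fintype.card (K ≃ₐ[ℚ] K) := by
  have hS := Finset.card_le_univ S
  rw [← Nat.add_sub_cancel' hS]
  rw [pow_add, wt]
  push_cast
  rw [norm_mul, norm_pow, norm_pow, norm_neg, Complex.norm_intCast, Complex.norm_intCast]
  have : 0 ≤ B := (abs_nonneg _).trans hx
  gcongr

theorem prod_le (ι : K →+* ℂ) (β : K) {x y : ℤ} {B : ℝ} (hB : 1 ≤ B) (hx : |(x : ℝ)| ≤ B)
    (hy : |(y : ℝ)| ≤ B) :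
    ‖∏ σ : K ≃ₐ[ℚ] K, (x * Complex.exp (ι (σ β)) - y)‖ ≤
      ‖x * Complex.exp (ι β) - y‖ *
        (B * (1 + ∑ σ : K ≃ₐ[ℚ] K, ‖Complex.exp (ι (σ β))‖)) ^ Fintype.card (K ≃ₐ[ℚ] K) := by
  classical
  set R := 1 + ∑ σ : K ≃ₐ[ℚ] K, ‖Complex.exp (ι (σ β))‖ with hR
  have hR1 : 1 ≤ R := by
    have : 0 ≤ ∑ σ : K ≃ₐ[ℚ] K, ‖Complex.exp (ι (σ β))‖ := Finset.sum_nonneg fun _ _ => norm_nonneg _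
    linarith
  have hfac : ∀ σ : K ≃ₐ[ℚ] K, ‖x * Complex.exp (ι (σ β)) - y‖ ≤ B * R := by
    intro σ
    refine (norm_sub_le _ _).trans ?_
    rw [norm_mul, Complex.norm_intCast, Complex.norm_intCast]
    have h1 : ‖Complex.exp (ι (σ β))‖ ≤ ∑ σ : K ≃ₐ[ℚ] K, ‖Complex.exp (ι (σ β))‖ :=
      Finset.single_le_sum (f := fun σ : K ≃ₐ[ℚ] K => ‖Complex.exp (ι (σ β))‖)
        (fun _ _ => norm_nonneg _) (Finset.mem_univ σ)
    rw [hR, mul_add, mul_one, add_comm]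
    gcongr
  rw [← Finset.mul_prod_erase univ _ (Finset.mem_univ 1), norm_mul, norm_prod]
  simp only [AlgEquiv.one_apply]
  gcongr
  calc _ ≤ ∏ σ ∈ univ.erase (1 : K ≃ₐ[ℚ] K), (B * R) :=
        Finset.prod_le_prod (fun _ _ => norm_nonneg _) fun σ _ => hfac σ
    _ = (B * R) ^ (univ.erase (1 : K ≃ₐ[ℚ] K)).card := by rw [Finset.prod_const]
    _ ≤ _ := pow_le_pow_right₀ (by nlinarith) (Finset.card_le_univ _)

theorem key [IsGalois ℚ K] (ι : K →+* ℂ) {β : K} (hβ : β ≠ 0) :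
    ∃ (d k P : ℕ) (C : ℝ), 1 ≤ C ∧ ∀ p > P, p.Prime → ∀ (B : ℝ), 1 ≤ B → ∀ x y : ℤ,
      |(x : ℝ)| ≤ B → |(y : ℝ)| ≤ B → ¬ ((p : ℤ) ∣ x ∧ (p : ℤ) ∣ y) →
      1 ≤ C ^ p * (p : ℝ) ^ (p * k) * B ^ d * ‖x * Complex.exp (ι β) - y‖ +
        C ^ p * B ^ d / ((p - 1)! : ℕ) := by
  classical
  obtain ⟨f, hf0, hf⟩ := exists_poly β
  obtain ⟨c, C₀, hc⟩ := exp_polynomial_approx_bound f hf0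
  have hfne : f ≠ 0 := by rintro rfl; simp at hf0
  have hl0 : f.leadingCoeff ≠ 0 := leadingCoeff_ne_zero.2 hfne
  set l := f.leadingCoeff with hl
  set d := Fintype.card (K ≃ₐ[ℚ] K) with hd
  set R := 1 + ∑ σ : K ≃ₐ[ℚ] K, ‖Complex.exp (ι (σ β))‖ with hR
  set H := 1 + ∑ T : Finset (K ≃ₐ[ℚ] K), ∑ τ : K ≃ₐ[ℚ] K, ‖Complex.exp (-ι (τ (bs β T)))‖ with hH
  set N : ℝ := ((Fintype.card (Finset (K ≃ₐ[ℚ] K) × (K ≃ₐ[ℚ] K)) : ℕ) : ℝ) with hN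
  set Q : ℝ := |(l : ℝ)| ^ f.natDegree with hQ
  have hR1 : 1 ≤ R := by
    have : 0 ≤ ∑ σ : K ≃ₐ[ℚ] K, ‖Complex.exp (ι (σ β))‖ := Finset.sum_nonneg fun _ _ => norm_nonneg _
    linarith
  have hH1 : 1 ≤ H := by
    have : 0 ≤ ∑ T : Finset (K ≃ₐ[ℚ] K), ∑ τ : K ≃ₐ[ℚ] K, ‖Complex.exp (-ι (τ (bs β T)))‖ :=
      Finset.sum_nonneg fun _ _ => Finset.sum_nonneg fun _ _ => norm_nonneg _
    linarith
  have hN1 : 1 ≤ N := by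
    rw [hN]; exact_mod_cast Fintype.card_pos
  have hQ1 : 1 ≤ Q := by
    refine one_le_pow₀ ?_
    exact_mod_cast Int.one_le_abs hl0
  have hd0 : 0 < d := Fintype.card_pos
  refine ⟨d, f.natDegree + 1, (eval 0 f).natAbs + l.natAbs + d,
    Q * (1 + |C₀|) * (1 + |c|) * (R ^ d * H) * N, ?_, ?_⟩
  · have h1 : 1 ≤ 1 + |C₀| := by linarith [abs_nonneg C₀]
    have h2 : 1 ≤ 1 + |c| := by linarith [abs_nonneg c]
    have h3 : 1 ≤ R ^ d := one_le_pow₀ hR1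
    exact one_le_mul_of_one_le_of_one_le (one_le_mul_of_one_le_of_one_le (one_le_mul_of_one_le_of_one_le (one_le_mul_of_one_le_of_one_le hQ1 h1) h2) (one_le_mul_of_one_le_of_one_le h3 hH1)) hN1
  intro p hp hpp B hB x y hx hy hxy
  obtain ⟨n, hpn, hn, g, hg, hgr⟩ := hc p (by lia) hpp
  obtain ⟨T, hT⟩ := exists_coeff hβ hpp x y hxy
  obtain ⟨z, hz⟩ := exists_int β x y T hf (hg.trans (Nat.sub_le _ _))
  set A := ∑ i : Finset (K ≃ₐ[ℚ] K) × (K ≃ₐ[ℚ] K) with bs β i.1 - i.2 (bs β T) = 0, wt K x y i.1 with hA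
  have hpZ : Prime (p : ℤ) := Nat.prime_iff_prime_int.1 hpp
  have hsmall : ∀ m : ℤ, m ≠ 0 → m.natAbs < p → ¬ (p : ℤ) ∣ m := by
    intro m hm hlt h
    have := Nat.le_of_dvd (Int.natAbs_pos.2 hm) (Int.natCast_dvd.1 h)
    lia
  have hAp : ¬ (p : ℤ) ∣ A := by
    intro h
    have hcc := const_coeff β x y T
    have e := Eq.trans (show A = _ from hA) hcc
    rw [e] at h
    rcases hpZ.dvd_or_dvd h with h | h
    · exact hsmall (d : ℤ) (by exact_mod_cast hd0.ne') (by simp; lia) h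
    · exact hT (by convert h)
  set M := p * f.natDegree with hM
  have hne : l ^ M * n * A + p * z ≠ 0 := by
    intro h0
    have : (p : ℤ) ∣ l ^ M * n * A := ⟨-z, by linarith⟩
    rcases hpZ.dvd_or_dvd this with h | h
    · rcases hpZ.dvd_or_dvd h with h | h
      · exact hsmall l hl0 (by lia) (hpZ.dvd_of_dvd_pow h)
      · exact hpn h
    · exact hAp h
  have h1 : (1 : ℝ) ≤ ‖((l ^ M * n * A + p * z : ℤ) : ℂ)‖ := by
    rw [Complex.norm_intCast]
    exact_mod_cast Int.one_le_abs hne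
  set E := ∑ i : Finset (K ≃ₐ[ℚ] K) × (K ≃ₐ[ℚ] K),
      (wt K x y i.1 : ℂ) * Complex.exp (ι (bs β i.1 - i.2 (bs β T))) with hE
  set Err := ∑ i : Finset (K ≃ₐ[ℚ] K) × (K ≃ₐ[ℚ] K) with ¬ bs β i.1 - i.2 (bs β T) = 0,
      (wt K x y i.1 : ℂ) * (n • Complex.exp (ι (bs β i.1 - i.2 (bs β T))) -
        p • aeval (ι (bs β i.1 - i.2 (bs β T))) g) with hErr
  have hz' : (l : ℂ) ^ M * ∑ i : Finset (K ≃ₐ[ℚ] K) × (K ≃ₐ[ℚ] K) with ¬ bs β i.1 - i.2 (bs β T) = 0,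
      (wt K x y i.1 : ℂ) * aeval (ι (bs β i.1 - i.2 (bs β T))) g = z := by
    have := congrArg ι hz
    rw [map_mul, map_pow, map_intCast, map_sum, map_intCast] at this
    rw [← this]
    congr 1
    refine Finset.sum_congr rfl fun i _ => ?_
    rw [map_mul, map_intCast]
    congr 1
    exact aeval_algHom_apply (ι.toIntAlgHom) _ g
  have hid : ((l ^ M * n * A + p * z : ℤ) : ℂ) = (l : ℂ) ^ M * n * E - (l : ℂ) ^ M * Err := by
    have hsplit : E = A + ∑ i : Finset (K ≃ₐ[ℚ] K) × (K ≃ₐ[ℚ] K) with ¬ bs β i.1 - i.2 (bs β T) = 0,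
      (wt K x y i.1 : ℂ) * Complex.exp (ι (bs β i.1 - i.2 (bs β T))) := by
      rw [hE, ← Finset.sum_filter_add_sum_filter_not univ (fun i : Finset (K ≃ₐ[ℚ] K) × (K ≃ₐ[ℚ] K) => bs β i.1 - i.2 (bs β T) = 0), hA]
      congr 1
      push_cast
      refine Finset.sum_congr rfl fun i hi => ?_
      rw [(Finset.mem_filter.1 hi).2]
      simp
    have herr : Err = n * (∑ i : Finset (K ≃ₐ[ℚ] K) × (K ≃ₐ[ℚ] K) with ¬ bs β i.1 - i.2 (bs β T) = 0,
      (wt K x y i.1 : ℂ) * Complex.exp (ι (bs β i.1 - i.2 (bs β T)))) -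
      p * ∑ i : Finset (K ≃ₐ[ℚ] K) × (K ≃ₐ[ℚ] K) with ¬ bs β i.1 - i.2 (bs β T) = 0,
      (wt K x y i.1 : ℂ) * aeval (ι (bs β i.1 - i.2 (bs β T))) g := by
      rw [hErr, Finset.mul_sum, Finset.mul_sum, ← Finset.sum_sub_distrib]
      refine Finset.sum_congr rfl fun i _ => ?_
      rw [zsmul_eq_mul, nsmul_eq_mul]
      ring
    rw [hsplit, herr]
    push_cast
    rw [← hz']
    ring
  have hEle : ‖E‖ ≤ ‖x * Complex.exp (ι β) - y‖ * (B * R) ^ d * H := by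
    rw [hE, E_eq, norm_mul]
    have h2 : ‖∑ τ : K ≃ₐ[ℚ] K, Complex.exp (-ι (τ (bs β T)))‖ ≤ H := by
      refine (norm_sum_le _ _).trans ?_
      have := Finset.single_le_sum (f := fun T : Finset (K ≃ₐ[ℚ] K) => ∑ τ : K ≃ₐ[ℚ] K, ‖Complex.exp (-ι (τ (bs β T)))‖)
        (fun _ _ => Finset.sum_nonneg fun _ _ => norm_nonneg _) (Finset.mem_univ T)
      linarith
    exact mul_le_mul (prod_le ι β hB hx hy) h2 (norm_nonneg _) (by positivity)
  have hcp : ∀ c : ℝ, c ^ p ≤ (1 + |c|) ^ p := fun c => (le_abs_self _).trans (by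
    rw [abs_pow]
    exact pow_le_pow_left₀ (abs_nonneg _) (by linarith) _)
  have hErrle : ‖Err‖ ≤ N * (B ^ d * ((1 + |c|) ^ p / ((p - 1)! : ℕ))) := by
    refine (norm_sum_le _ _).trans ?_
    have hterm : ∀ i ∈ (univ.filter fun i : Finset (K ≃ₐ[ℚ] K) × (K ≃ₐ[ℚ] K) => ¬ bs β i.1 - i.2 (bs β T) = 0),
      ‖(wt K x y i.1 : ℂ) * (n • Complex.exp (ι (bs β i.1 - i.2 (bs β T))) -
        p • aeval (ι (bs β i.1 - i.2 (bs β T))) g)‖ ≤ B ^ d * ((1 + |c|) ^ p / ((p - 1)! : ℕ)) := by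
      intro i hi
      have hi' := (Finset.mem_filter.1 hi).2
      rw [norm_mul]
      refine mul_le_mul (wt_le hx hy _) ?_ (norm_nonneg _) (by positivity)
      refine (hgr ?_).trans ?_
      · rw [mem_aroots]
        refine ⟨hfne, ?_⟩
        have := aeval_algHom_apply (ι.toIntAlgHom) (bs β i.1 - i.2 (bs β T)) f
        rw [hf _ _ _ hi', map_zero] at this
        exact this
      · exact div_le_div_of_nonneg_right (hcp c) (by positivity)
    refine (Finset.sum_le_sum hterm).trans ?_
    rw [Finset.sum_const, nsmul_eq_mul]
    gcongr
    rw [hN]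
    exact_mod_cast Finset.card_le_univ _
  have hlM : ‖(l : ℂ) ^ M‖ = Q ^ p := by
    rw [norm_pow, Complex.norm_intCast, hQ, ← pow_mul, hM, mul_comm]
  have hnle : ‖(n : ℂ)‖ ≤ (1 + |C₀|) ^ p * (p : ℝ) ^ (p * (f.natDegree + 1)) := by
    rw [Complex.norm_intCast]
    exact hn.trans (mul_le_mul_of_nonneg_right (hcp C₀) (by positivity))
  have hp0 : p ≠ 0 := hpp.ne_zero
  rw [hid] at h1
  refine h1.trans ((norm_sub_le _ _).trans (add_le_add ?_ ?_))
  · rw [norm_mul, norm_mul, hlM]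
    have hRH : R ^ d * H ≤ (R ^ d * H) ^ p :=
      le_self_pow₀ (one_le_mul_of_one_le_of_one_le (one_le_pow₀ hR1) hH1) hp0
    have hc1 : 1 ≤ (1 + |c|) ^ p := one_le_pow₀ (by linarith [abs_nonneg c])
    have hN1' : 1 ≤ N ^ p := one_le_pow₀ hN1
    calc Q ^ p * ‖(n : ℂ)‖ * ‖E‖ ≤ Q ^ p * ((1 + |C₀|) ^ p * (p : ℝ) ^ (p * (f.natDegree + 1))) *
          (‖x * Complex.exp (ι β) - y‖ * (B * R) ^ d * H) := by gcongr
      _ = Q ^ p * ((1 + |C₀|) ^ p * (p : ℝ) ^ (p * (f.natDegree + 1))) * B ^ d *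
          ‖x * Complex.exp (ι β) - y‖ * (1 * (R ^ d * H) * 1) := by
        rw [mul_pow]; ring
      _ ≤ Q ^ p * ((1 + |C₀|) ^ p * (p : ℝ) ^ (p * (f.natDegree + 1))) * B ^ d *
          ‖x * Complex.exp (ι β) - y‖ * ((1 + |c|) ^ p * (R ^ d * H) ^ p * N ^ p) := by
        gcongr
      _ = _ := by simp only [mul_pow]; ring
  · rw [norm_mul, hlM]
    have hRH : 1 ≤ (R ^ d * H) ^ p :=
      one_le_pow₀ (one_le_mul_of_one_le_of_one_le (one_le_pow₀ hR1) hH1)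
    have hC1 : 1 ≤ (1 + |C₀|) ^ p := one_le_pow₀ (by linarith [abs_nonneg C₀])
    have hN1' : N ≤ N ^ p := le_self_pow₀ hN1 hp0
    calc Q ^ p * ‖Err‖ ≤ Q ^ p * (N * (B ^ d * ((1 + |c|) ^ p / ((p - 1)! : ℕ)))) := by gcongr
      _ = Q ^ p * (1 + |c|) ^ p * (B ^ d / ((p - 1)! : ℕ)) * (1 * 1 * N) := by ring
      _ ≤ Q ^ p * (1 + |c|) ^ p * (B ^ d / ((p - 1)! : ℕ)) * ((1 + |C₀|) ^ p * (R ^ d * H) ^ p * N ^ p) := by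
        gcongr
      _ = _ := by simp only [mul_pow]; ring

end Key

section Final

open scoped Nat

theorem choose_prime (d k P : ℕ) {C : ℝ} (hC : 1 ≤ C) :
    ∃ N B₀ : ℕ, ∀ B : ℕ, B₀ ≤ B → ∃ p : ℕ, p.Prime ∧ P < p ∧ 2 < p ∧
      C ^ p * (B : ℝ) ^ d / ((p - 1)! : ℕ) ≤ 1 / 2 ∧
      C ^ p * (p : ℝ) ^ (p * k) * (B : ℝ) ^ d ≤ (B : ℝ) ^ N := by
  set D := d + 1 with hD
  obtain ⟨m₁, hm₁⟩ := exists_nat_gt (2 * (3 * C ^ 2) ^ D + C)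
  set m₀ := m₁ + P + 2 * D + 3 with hm₀
  refine ⟨4 * (2 * D * (2 * k + 1)) + d, m₀ ^ m₀ + 1, fun B hB => ?_⟩
  have hB1 : 1 ≤ B := by lia
  have hex : ∃ m : ℕ, B ≤ m ^ m := ⟨B, Nat.le_self_pow (by lia) B⟩
  classical
  obtain ⟨m, hm, hmin⟩ : ∃ m : ℕ, B ≤ m ^ m ∧ ∀ j < m, j ^ j < B :=
    ⟨Nat.find hex, Nat.find_spec hex, fun j hj => not_le.1 (Nat.find_min hex hj)⟩
  have hmm₀ : m₀ < m := by
    by_contra! h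
    have h1 : m ^ m ≤ m₀ ^ m₀ :=
      (Nat.pow_le_pow_left h m).trans (Nat.pow_le_pow_right (by lia) h)
    lia
  have hDm : D * m ≠ 0 := by
    apply Nat.mul_ne_zero <;> lia
  obtain ⟨p, hp, hlt, hle⟩ := Nat.exists_prime_lt_and_le_two_mul (D * m) hDm
  have hmD : m ≤ D * m := Nat.le_mul_of_pos_left m (by lia)
  have hm₁R : (m₁ : ℝ) ≤ m := by exact_mod_cast (by lia : m₁ ≤ m)
  have hmpos : (0 : ℝ) < m := by exact_mod_cast (by lia : 0 < m)
  have hm1 : (1 : ℝ) ≤ m := by exact_mod_cast (by lia : 1 ≤ m)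
  have hBm : (B : ℝ) ≤ (m : ℝ) ^ m := by exact_mod_cast hm
  have h3C : (0 : ℝ) ≤ 2 * (3 * C ^ 2) ^ D := by positivity
  have hCm : C ≤ m := by linarith
  refine ⟨p, hp, by lia, by lia, ?_, ?_⟩
  · have hfac : (((D * m : ℕ) : ℝ)) ^ (D * m) ≤ 3 ^ (D * m) * ((p - 1)! : ℕ) := by
      have h1 := Real.pow_div_factorial_le_exp ((D * m : ℕ) : ℝ) (by positivity) (D * m)
      have h2 : Real.exp ((D * m : ℕ) : ℝ) ≤ 3 ^ (D * m) := by
        rw [← Real.exp_one_pow]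
        gcongr
        exact Real.exp_one_lt_three.le
      rw [div_le_iff₀ (by positivity)] at h1
      refine h1.trans ?_
      gcongr
      lia
    have hfac2 : (m : ℝ) ^ (D * m) ≤ 3 ^ (D * m) * ((p - 1)! : ℕ) := by
      refine le_trans ?_ hfac
      gcongr
    rw [div_le_iff₀ (by positivity)]
    have h5 : C ^ p * (B : ℝ) ^ d ≤ (C ^ 2) ^ (D * m) * ((m : ℝ) ^ m) ^ d := by
      rw [← pow_mul]
      gcongr
    have h6 : 2 * (3 * C ^ 2) ^ (D * m) ≤ (m : ℝ) ^ m := by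
      have h7 : (2 * (3 * C ^ 2) ^ D) ^ m ≤ (m : ℝ) ^ m := by
        gcongr; linarith
      refine le_trans ?_ h7
      have e : (2 * (3 * C ^ 2) ^ D) ^ m = 2 ^ m * (3 * C ^ 2) ^ (D * m) := by
        rw [mul_pow 2, ← pow_mul]
      rw [e]
      have h2m : (2 : ℝ) ≤ 2 ^ m := le_self_pow₀ (by norm_num) (by lia)
      exact mul_le_mul_of_nonneg_right h2m (by positivity)
    have h8 : 3 ^ (D * m) * (C ^ p * (B : ℝ) ^ d) ≤ 3 ^ (D * m) * (1 / 2 * ((p - 1)! : ℕ)) := by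
      calc 3 ^ (D * m) * (C ^ p * (B : ℝ) ^ d)
          ≤ 3 ^ (D * m) * ((C ^ 2) ^ (D * m) * ((m : ℝ) ^ m) ^ d) := by gcongr
        _ = 1 / 2 * ((2 * (3 * C ^ 2) ^ (D * m)) * ((m : ℝ) ^ m) ^ d) := by
          rw [mul_pow 3]; ring
        _ ≤ 1 / 2 * ((m : ℝ) ^ m * ((m : ℝ) ^ m) ^ d) := by gcongr
        _ = 1 / 2 * (m : ℝ) ^ (D * m) := by rw [hD]; ring
        _ ≤ 1 / 2 * (3 ^ (D * m) * ((p - 1)! : ℕ)) := by gcongr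
        _ = _ := by ring
    exact le_of_mul_le_mul_left h8 (by positivity)
  · have hpm : (p : ℝ) ≤ (m : ℝ) ^ 2 := by
      have : p ≤ m ^ 2 := by nlinarith
      exact_mod_cast this
    have hmB : (m : ℝ) ^ m ≤ (B : ℝ) ^ 4 := by
      have h1 := hmin (m - 1) (by lia)
      obtain ⟨j, rfl⟩ : ∃ j, m = j + 1 := ⟨m - 1, by lia⟩
      rw [Nat.add_sub_cancel] at h1
      have h2 : (j + 1) ^ (j + 1) ≤ (j ^ j) ^ 4 := by
        calc (j + 1) ^ (j + 1) ≤ (j ^ 2) ^ (j + 1) := Nat.pow_le_pow_left (by nlinarith) _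
          _ = j ^ (2 * (j + 1)) := by rw [← pow_mul]
          _ ≤ j ^ (j * 4) := Nat.pow_le_pow_right (by lia) (by lia)
          _ = _ := by rw [pow_mul]
      exact_mod_cast h2.trans (Nat.pow_le_pow_left h1.le 4)
    calc C ^ p * (p : ℝ) ^ (p * k) * (B : ℝ) ^ d
        ≤ (m : ℝ) ^ p * ((m : ℝ) ^ 2) ^ (p * k) * (B : ℝ) ^ d := by gcongr
      _ = (m : ℝ) ^ (p * (2 * k + 1)) * (B : ℝ) ^ d := by ring
      _ ≤ (m : ℝ) ^ (2 * (D * m) * (2 * k + 1)) * (B : ℝ) ^ d := by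
        gcongr
      _ = ((m : ℝ) ^ m) ^ (2 * D * (2 * k + 1)) * (B : ℝ) ^ d := by ring
      _ ≤ ((B : ℝ) ^ 4) ^ (2 * D * (2 * k + 1)) * (B : ℝ) ^ d := by gcongr
      _ = _ := by ring

theorem exp_measure {β : ℝ} (hβ : β ≠ 0) (halg : IsAlgebraic ℚ β) :
    ∃ N B₀ : ℕ, ∀ B : ℕ, B₀ ≤ B → ∀ x y : ℤ, |x| ≤ B → |y| ≤ B →
      (∀ p : ℕ, p.Prime → 2 < p → ¬ ((p : ℤ) ∣ x ∧ (p : ℤ) ∣ y)) →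
      1 / 2 ≤ (B : ℝ) ^ N * |x * Real.exp β - y| := by
  have halg' : IsAlgebraic ℚ (β : ℂ) := halg.algebraMap (A := ℂ)
  have hIntg : IsIntegral ℚ (β : ℂ) := halg'.isIntegral
  set f := minpoly ℚ (β : ℂ) with hf
  have hfne : f ≠ 0 := minpoly.ne_zero hIntg
  let K := IntermediateField.adjoin ℚ (f.rootSet ℂ)
  have hs : f.IsSplittingField ℚ K :=
    IntermediateField.adjoin_rootSet_isSplittingField (IsAlgClosed.splits _)
  have hfd : FiniteDimensional ℚ K := Polynomial.IsSplittingField.finiteDimensional K f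
  have hnf : NumberField K := { to_charZero := inferInstance, to_finiteDimensional := hfd }
  have hgal : IsGalois ℚ K := IsGalois.of_separable_splitting_field (p := f) (minpoly.irreducible hIntg).separable
  have hmem : (β : ℂ) ∈ K := by
    refine IntermediateField.subset_adjoin _ _ ?_
    rw [Polynomial.mem_rootSet]
    exact ⟨hfne, minpoly.aeval _ _⟩
  have hβ' : (⟨(β : ℂ), hmem⟩ : K) ≠ 0 := by
    intro h
    have := congrArg (fun z : K => (z : ℂ)) h
    simp at this
    exact hβ this
  obtain ⟨d, k, P, C, hC, H⟩ := key (algebraMap K ℂ) hβ'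
  obtain ⟨N, B₀, hN⟩ := choose_prime d k P hC
  refine ⟨N, B₀ + 1, fun B hB x y hx hy hxy => ?_⟩
  obtain ⟨p, hp, hpP, hp2, h1, h2⟩ := hN B (by lia)
  have h3 := H p hpP hp B (by exact_mod_cast (by lia : 1 ≤ B)) x y (by exact_mod_cast hx)
    (by exact_mod_cast hy) (hxy p hp hp2)
  have h4 : ‖(x : ℂ) * Complex.exp (algebraMap K ℂ ⟨(β : ℂ), hmem⟩) - y‖ = |x * Real.exp β - y| := by
    rw [← Real.norm_eq_abs, ← Complex.norm_real]
    push_cast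
    rfl
  rw [h4] at h3
  have h5 := mul_le_mul_of_nonneg_right h2 (abs_nonneg (x * Real.exp β - y))
  linarith

end Final

end LWQuant

theorem liouville_artanh_transcendental (α : ℝ) (h : Liouville α) (hlt : |α| < 1) :
    Transcendental ℚ ((1 / 2) * Real.log ((1 + α) / (1 - α))) := by
  intro halg
  obtain ⟨hl, hr⟩ := abs_lt.1 hlt
  have h1 : 0 < 1 - α := by linarith
  have h2 : 0 < 1 + α := by linarith
  set β := Real.log ((1 + α) / (1 - α)) with hβ
  have hα0 : α ≠ 0 := h.irrational.ne_zero
  have hexp : Real.exp β = (1 + α) / (1 - α) := Real.exp_log (by positivity)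
  have hβ0 : β ≠ 0 := by
    intro h0
    rw [h0, Real.exp_zero, eq_div_iff h1.ne'] at hexp
    apply hα0
    linarith
  have hβalg : IsAlgebraic ℚ β := by
    have h2 : IsAlgebraic ℚ (2 : ℝ) := by simpa using isAlgebraic_algebraMap (R := ℚ) (A := ℝ) 2
    have := h2.mul halg
    rwa [show (2 : ℝ) * (1 / 2 * β) = β by ring] at this
  obtain ⟨N, B₀, hN⟩ := LWQuant.exp_measure hβ0 hβalg
  obtain ⟨b₁, hb₁⟩ := exists_nat_gt (4 * 3 ^ N / (1 - α))
  obtain ⟨b, hb, a, hne, hab⟩ := ((Filter.eventually_ge_atTop (b₁ + B₀ + 1)).and_frequently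
    (h.frequently_exists_num (N + 2))).exists
  have hbpos : (0 : ℝ) < b := by exact_mod_cast (by lia : 0 < b)
  have hb1 : (1 : ℝ) ≤ b := by exact_mod_cast (by lia : 1 ≤ b)
  set r : ℚ := (a : ℚ) / (b : ℚ) with hrdef
  have hrR : ((a : ℝ) / (b : ℝ)) = (r.num : ℝ) / (r.den : ℝ) := by
    have h3 : ((r : ℚ) : ℝ) = (r.num : ℝ) / (r.den : ℝ) := Rat.cast_def r
    rw [← h3, hrdef]
    push_cast
    rfl
  have hdenle : r.den ≤ b := by
    have h3 : ((r.den : ℕ) : ℤ) ∣ (b : ℤ) := by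
      have := Rat.den_dvd a (b : ℤ)
      rw [Rat.divInt_eq_div] at this
      rw [hrdef]
      push_cast at this ⊢
      exact this
    exact Nat.le_of_dvd (by lia) (Int.natCast_dvd_natCast.1 h3)
  have hdpos : (0 : ℝ) < r.den := by exact_mod_cast r.den_pos
  have hdenR : (r.den : ℝ) ≤ b := by exact_mod_cast hdenle
  rw [hrR] at hab
  have hlt1 : |α - (r.num : ℝ) / r.den| < 1 :=
    hab.trans_le (by rw [div_le_one (by positivity)]; exact one_le_pow₀ hb1)
  have hlin : |α * r.den - r.num| = r.den * |α - (r.num : ℝ) / r.den| := by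
    rw [← abs_of_pos hdpos, ← abs_mul, abs_of_pos hdpos]
    congr 1
    field_simp
  have hnum : |(r.num : ℝ)| ≤ 2 * r.den := by
    have h3 : |α * r.den - r.num| ≤ r.den := by
      rw [hlin]
      nlinarith
    rw [abs_le] at h3 ⊢
    constructor <;> nlinarith
  have hnumZ : |r.num| ≤ 2 * (r.den : ℤ) := by exact_mod_cast hnum
  rw [abs_le] at hnumZ
  have h4 := hN (3 * b) (by lia) (r.den - r.num) (r.den + r.num)
    (by rw [abs_le]; constructor <;> push_cast <;> lia)
    (by rw [abs_le]; constructor <;> push_cast <;> lia) (by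
      rintro p hp hp2 ⟨hx, hy⟩
      have hpZ : Prime (p : ℤ) := Nat.prime_iff_prime_int.1 hp
      have h2p : ¬ (p : ℤ) ∣ 2 := by
        intro h2
        have := Int.le_of_dvd (by norm_num) h2
        lia
      have hd : (p : ℤ) ∣ 2 * (r.den : ℤ) := by
        have := dvd_add hx hy
        rwa [show (r.den : ℤ) - r.num + (r.den + r.num) = 2 * r.den by ring] at this
      have hn : (p : ℤ) ∣ 2 * r.num := by
        have := dvd_sub hy hx
        rwa [show (r.den : ℤ) + r.num - (r.den - r.num) = 2 * r.num by ring] at this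
      have hd' := (hpZ.dvd_or_dvd hd).resolve_left h2p
      have hn' := (hpZ.dvd_or_dvd hn).resolve_left h2p
      have := Nat.dvd_gcd (Int.natCast_dvd.1 hn') (Int.natCast_dvd_natCast.1 hd')
      rw [r.reduced.gcd_eq_one] at this
      exact hp.one_lt.ne' (Nat.dvd_one.1 this))
  have h5 : |((r.den - r.num : ℤ) : ℝ) * Real.exp β - ((r.den + r.num : ℤ) : ℝ)| =
      2 / (1 - α) * (r.den * |α - (r.num : ℝ) / r.den|) := by
    have h6 : |2 / (1 - α)| = 2 / (1 - α) := abs_of_pos (by positivity)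
    rw [← hlin, ← h6, ← abs_mul, hexp]
    congr 1
    push_cast
    field_simp
    ring
  rw [h5] at h4
  have hb₁b : (b₁ : ℝ) ≤ b := by exact_mod_cast (by lia : b₁ ≤ b)
  have h6 : ((3 * b : ℕ) : ℝ) ^ N * (2 / (1 - α) * (r.den * |α - (r.num : ℝ) / r.den|)) ≤
      (3 * b : ℝ) ^ N * (2 / (1 - α) * (b * (1 / (b : ℝ) ^ (N + 2)))) := by
    push_cast
    gcongr
  have h7 : (3 * b : ℝ) ^ N * (2 / (1 - α) * (b * (1 / (b : ℝ) ^ (N + 2)))) =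
      (4 * 3 ^ N / (1 - α)) / (2 * b) := by
    field_simp
    ring
  have h8 : (4 * 3 ^ N / (1 - α)) / (2 * b) < 1 / 2 := by
    rw [div_lt_iff₀ (by positivity)]
    linarith
  linarith
end

section
/- No Liouville number is an integer multiple of π; i.e., if α is a Liouville number then for every integer k, α ≠ k·π. -/
namespace PiNL
open PowerSeries Finset

noncomputable def pinv (b : ℂ) : ℂ⟦X⟧ := PowerSeries.mk fun r => (-1) ^ r / b ^ (r + 1)

lemma pinv_mul {b : ℂ} (hb : b ≠ 0) : pinv b * (X + C b) = 1 := by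
  ext r
  rw [mul_add]
  cases r with
  | zero => simp [pinv, hb]
  | succ r =>
    simp only [map_add, coeff_succ_mul_X, coeff_mul_C, pinv, coeff_mk, coeff_one]
    field_simp
    simp [pow_succ]
    ring

variable {ι : Type*} [Fintype ι] [DecidableEq ι]

noncomputable def EE (v : ι → ℂ) (ρ : ι → ℕ) (k : ι) : ℂ⟦X⟧ :=
  ∏ i ∈ univ.erase k, pinv (v k - v i) ^ ρ i

noncomputable def Lam (v : ι → ℂ) (ρ : ι → ℕ) (f : Polynomial ℂ) : ℂ :=
  ∑ k, coeff (ρ k) (X * ((Polynomial.taylor (v k) f : Polynomial ℂ) : ℂ⟦X⟧) * EE v ρ k)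

noncomputable def aa (v : ι → ℂ) (ρ : ι → ℕ) (k : ι) : Polynomial ℂ :=
  ∑ j ∈ range (ρ k), Polynomial.monomial j (coeff (ρ k - 1 - j) (EE v ρ k) / (j.factorial : ℂ))

noncomputable def RR (v : ι → ℂ) (ρ : ι → ℕ) : ℂ⟦X⟧ :=
  ∑ k, (aa v ρ k : ℂ⟦X⟧) * rescale (v k) (exp ℂ)

lemma coeff_monomial_mul_exp (j s : ℕ) (c v : ℂ) :
    coeff s (((Polynomial.monomial j c : Polynomial ℂ) : ℂ⟦X⟧) * rescale v (exp ℂ)) =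
      if j ≤ s then c * (v ^ (s - j) / ((s - j).factorial : ℂ)) else 0 := by
  have : ((Polynomial.monomial j c : Polynomial ℂ) : ℂ⟦X⟧) = C c * X ^ j := by
    rw [← Polynomial.C_mul_X_pow_eq_monomial]; simp
  rw [this, mul_assoc, coeff_C_mul, coeff_X_pow_mul']
  split_ifs <;> simp [coeff_exp, div_eq_mul_inv]

lemma coeff_RR (v : ι → ℂ) (ρ : ι → ℕ) (s : ℕ) :
    (s.factorial : ℂ) * coeff s (RR v ρ) = Lam v ρ (Polynomial.X ^ s) := by
  unfold RR Lam
  rw [map_sum, mul_sum]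
  refine sum_congr rfl fun k _ => ?_
  have hc : ((aa v ρ k : Polynomial ℂ) : ℂ⟦X⟧) = ∑ j ∈ range (ρ k),
      ((Polynomial.monomial j (coeff (ρ k - 1 - j) (EE v ρ k) / (j.factorial : ℂ)) : Polynomial ℂ) : ℂ⟦X⟧) := by
    unfold aa
    simp only [← Polynomial.coeToPowerSeries.ringHom_apply]
    exact map_sum (Polynomial.coeToPowerSeries.ringHom (R := ℂ)) _ _
  rw [hc, sum_mul, map_sum]
  simp only [coeff_monomial_mul_exp]
  rcases h : ρ k with _ | r
  · simp [mul_assoc]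
  rw [mul_assoc, coeff_succ_X_mul, coeff_mul, Nat.sum_antidiagonal_eq_sum_range_succ_mk, mul_sum]
  refine sum_congr rfl fun j hj => ?_
  rw [Polynomial.taylor_pow, Polynomial.taylor_X, Polynomial.coeff_coe, Polynomial.coeff_X_add_C_pow]
  split_ifs with hjs
  · rw [Nat.add_sub_cancel]
    have := Nat.choose_mul_factorial_mul_factorial hjs
    rw [← this]
    push_cast
    have h1 : (j.factorial : ℂ) ≠ 0 := by exact_mod_cast j.factorial_ne_zero
    have h2 : ((s-j).factorial : ℂ) ≠ 0 := by exact_mod_cast (s-j).factorial_ne_zero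
    field_simp
  · rw [Nat.choose_eq_zero_of_lt (by omega)]; simp

lemma Lam_add (v : ι → ℂ) (ρ : ι → ℕ) (f g : Polynomial ℂ) :
    Lam v ρ (f + g) = Lam v ρ f + Lam v ρ g := by
  simp [Lam, mul_add, add_mul, sum_add_distrib]

lemma Lam_C_mul (v : ι → ℂ) (ρ : ι → ℕ) (c : ℂ) (g : Polynomial ℂ) :
    Lam v ρ (Polynomial.C c * g) = c * Lam v ρ g := by
  simp only [Lam, mul_sum]
  refine sum_congr rfl fun k _ => ?_
  rw [Polynomial.taylor_mul, Polynomial.taylor_C, Polynomial.coe_mul, Polynomial.coe_C,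
    mul_left_comm, mul_assoc, coeff_C_mul]

lemma Lam_mul {v : ι → ℂ} (hv : Function.Injective v) (ρ : ι → ℕ) (a : ι) (f : Polynomial ℂ) :
    Lam v (ρ + Pi.single a 1) (f * (Polynomial.X - Polynomial.C (v a))) = Lam v ρ f := by
  unfold Lam
  refine sum_congr rfl fun k _ => ?_
  have ht : ((Polynomial.taylor (v k) (f * (Polynomial.X - Polynomial.C (v a))) : Polynomial ℂ) : ℂ⟦X⟧)
      = ((Polynomial.taylor (v k) f : Polynomial ℂ) : ℂ⟦X⟧) * (X + C (v k - v a)) := by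
    rw [Polynomial.taylor_mul, map_sub, Polynomial.taylor_X, Polynomial.taylor_C]
    simp only [Polynomial.coe_mul, Polynomial.coe_sub, Polynomial.coe_add, Polynomial.coe_X, Polynomial.coe_C, map_sub]
    ring
  rw [ht]
  by_cases hk : k = a
  · subst hk
    have : EE v (ρ + Pi.single k 1) k = EE v ρ k := by
      unfold EE
      refine prod_congr rfl fun i hi => ?_
      simp [(mem_erase.1 hi).1]
    rw [this]
    simp only [Pi.add_apply, Pi.single_eq_same, sub_self, map_zero, add_zero]
    rw [show X * (((Polynomial.taylor (v k) f : Polynomial ℂ) : ℂ⟦X⟧) * X) * EE v ρ k =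
      X * (X * ((Polynomial.taylor (v k) f : Polynomial ℂ) : ℂ⟦X⟧) * EE v ρ k) by ring, coeff_succ_X_mul]
  · have : EE v (ρ + Pi.single a 1) k * (X + C (v k - v a)) = EE v ρ k := by
      unfold EE
      have ha : a ∈ univ.erase k := by simp [Ne.symm hk]
      rw [← mul_prod_erase _ _ ha, ← mul_prod_erase _ (fun i => pinv (v k - v i) ^ ρ i) ha]
      have : ∏ x ∈ (univ.erase k).erase a, pinv (v k - v x) ^ (ρ + Pi.single a 1 : ι → ℕ) x
        = ∏ x ∈ (univ.erase k).erase a, pinv (v k - v x) ^ ρ x := by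
        refine prod_congr rfl fun i hi => ?_
        simp [(mem_erase.1 hi).1]
      rw [this]
      simp only [Pi.add_apply, Pi.single_eq_same, pow_succ]
      have h1 := pinv_mul (b := v k - v a) (sub_ne_zero.2 fun h => hk (hv h))
      linear_combination (pinv (v k - v a) ^ ρ a * ∏ x ∈ (univ.erase k).erase a, pinv (v k - v x) ^ ρ x) * h1
    rw [← this]
    simp only [Pi.add_apply, Pi.single_apply, hk, if_false, add_zero]
    congr 1
    ring

lemma exists_single (ρ : ι → ℕ) (h : 0 < ∑ i, ρ i) : ∃ (a : ι) (ρ' : ι → ℕ), ρ = ρ' + Pi.single a 1 := by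
  obtain ⟨a, _, ha⟩ := exists_ne_zero_of_sum_ne_zero h.ne'
  refine ⟨a, ρ - Pi.single a 1, ?_⟩
  ext i
  by_cases hi : i = a
  · subst hi; simp; omega
  · simp [hi]

lemma sum_single_add (ρ : ι → ℕ) (a : ι) : ∑ i, (ρ + Pi.single a 1 : ι → ℕ) i = ∑ i, ρ i + 1 := by
  simp [sum_add_distrib]

lemma Lam_one_single (v : ι → ℂ) (a : ι) (n : ℕ) : Lam v (Pi.single a (n+1)) 1 = if n = 0 then 1 else 0 := by
  unfold Lam
  rw [sum_eq_single a]
  · have : EE v (Pi.single a (n+1)) a = 1 := by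
      unfold EE
      refine prod_eq_one fun i hi => ?_
      simp [(mem_erase.1 hi).1]
    rw [this]
    simp [coeff_X]
  · intro k _ hk
    simp [hk]
  · simp

lemma Lam_eq {v : ι → ℂ} (hv : Function.Injective v) (d : ℕ) : ∀ (ρ : ι → ℕ), ∑ i, ρ i = d + 1 →
    ∀ f : Polynomial ℂ, f.natDegree ≤ d → Lam v ρ f = f.coeff d := by
  induction d with
  | zero =>
    intro ρ hρ f hf
    obtain ⟨a, ρ', rfl⟩ := exists_single ρ (by omega)
    rw [sum_single_add] at hρ
    have : ρ' = 0 := by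
      ext i
      exact (sum_eq_zero_iff.1 (by omega : ∑ i, ρ' i = 0)) i (mem_univ _)
    subst this
    rw [Polynomial.eq_C_of_natDegree_le_zero hf, ← mul_one (Polynomial.C _), Lam_C_mul, zero_add,
      Lam_one_single v a 0]
    simp
  | succ d ih =>
    intro ρ hρ f hf
    have h1 : Lam v ρ 1 = 0 := by
      obtain ⟨a, ρ', rfl⟩ := exists_single ρ (by omega)
      by_cases h : ∃ b, b ≠ a ∧ ρ' b ≠ 0
      · obtain ⟨b, hba, hb⟩ := h
        obtain ⟨ρ'', rfl⟩ : ∃ ρ'' : ι → ℕ, ρ' = ρ'' + Pi.single b 1 := by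
          refine ⟨ρ' - Pi.single b 1, ?_⟩
          ext i
          by_cases hi : i = b
          · subst hi; simp; omega
          · simp [hi]
        rw [sum_single_add, sum_single_add] at hρ
        have e1 := Lam_mul hv (ρ'' + Pi.single b 1) a 1
        have e2 := Lam_mul hv (ρ'' + Pi.single a 1) b 1
        rw [ih _ (by rw [sum_single_add]; omega) 1 (by simp)] at e1 e2
        rw [add_right_comm ρ'' _ (Pi.single b 1)] at e2
        have e3 : (1 * (Polynomial.X - Polynomial.C (v a)) : Polynomial ℂ) =
            1 * (Polynomial.X - Polynomial.C (v b)) + Polynomial.C (v b - v a) * 1 := by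
          simp
        rw [e3, Lam_add, Lam_C_mul, e2] at e1
        have : v b - v a ≠ 0 := sub_ne_zero.2 fun h => hba (hv h)
        have e4 : (v b - v a) * Lam v (ρ'' + Pi.single b 1 + Pi.single a 1) 1 = 0 := by
          linear_combination e1
        exact (mul_eq_zero.1 e4).resolve_left this
      · push Not at h
        have : ρ' + Pi.single a 1 = Pi.single a (ρ' a + 1) := by
          ext i
          by_cases hi : i = a
          · subst hi; simp
          · simp [hi, h i hi]
        rw [this] at hρ ⊢
        rw [Lam_one_single]
        simp at hρ
        simp [hρ]
    obtain ⟨a, ρ', rfl⟩ := exists_single ρ (by omega)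
    rw [sum_single_add] at hρ
    have hf2 := Polynomial.modByMonic_add_div f (Polynomial.X - Polynomial.C (v a))
    rw [Polynomial.modByMonic_X_sub_C_eq_C_eval, mul_comm] at hf2
    set g := f /ₘ (Polynomial.X - Polynomial.C (v a))
    have hg : g.natDegree ≤ d := by
      rw [Polynomial.natDegree_divByMonic _ (Polynomial.monic_X_sub_C _), Polynomial.natDegree_X_sub_C]
      omega
    rw [← hf2, Lam_add, Lam_mul hv, ← mul_one (Polynomial.C (f.eval _)), Lam_C_mul, h1, ih _ (by omega) g hg]
    simp only [mul_zero, zero_add, mul_one, Polynomial.coeff_add, Polynomial.coeff_C_succ, mul_sub,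
      Polynomial.coeff_sub, Polynomial.coeff_mul_X, Polynomial.coeff_mul_C]
    rw [Polynomial.coeff_eq_zero_of_natDegree_lt (show g.natDegree < d + 1 by omega)]
    simp

lemma RR_vanish {v : ι → ℂ} (hv : Function.Injective v) (ρ : ι → ℕ) (s : ℕ) (hs : s + 1 < ∑ i, ρ i) :
    coeff s (RR v ρ) = 0 := by
  have h := coeff_RR v ρ s
  obtain ⟨d, hd⟩ : ∃ d, ∑ i, ρ i = d + 1 := ⟨∑ i, ρ i - 1, by omega⟩
  rw [Lam_eq hv d ρ hd _ (by simp; omega), Polynomial.coeff_X_pow, if_neg (by omega)] at h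
  exact (mul_eq_zero.1 h).resolve_left (by exact_mod_cast s.factorial_ne_zero)

lemma aa_natDegree (v : ι → ℂ) (ρ : ι → ℕ) (k : ι) : (aa v ρ k).natDegree ≤ ρ k - 1 := by
  refine Polynomial.natDegree_sum_le_of_forall_le _ _ fun j hj => ?_
  refine (Polynomial.natDegree_monomial_le _).trans ?_
  have := mem_range.1 hj
  omega

lemma aa_coeff (v : ι → ℂ) (ρ : ι → ℕ) (k : ι) (j : ℕ) : (aa v ρ k).coeff j =
    if j < ρ k then coeff (ρ k - 1 - j) (EE v ρ k) / (j.factorial : ℂ) else 0 := by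
  unfold aa
  simp [Polynomial.finsetSum_coeff, Polynomial.coeff_monomial]

/-- the determinant argument -/
lemma det_ne {v : ι → ℂ} (hv : Function.Injective v) [Nonempty ι] (n : ℕ) (x : ℂ) (hx : x ≠ 0)
    (w : ι → ℂ) (hw : w ≠ 0) :
    ∃ l, ∑ k, w k * (aa v (fun i => n + (if i = l then 1 else 0)) k).eval x ≠ 0 := by
  by_contra! hcon
  let ρ : ι → ι → ℕ := fun l i => n + (if i = l then 1 else 0)
  let A : Matrix ι ι (Polynomial ℂ) := Matrix.of fun l k => aa v (ρ l) k
  have hcoef : (A.det).coeff (Fintype.card ι * n) ≠ 0 := by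
    have h1 : (A.det).coeff (Fintype.card ι * n) = Matrix.det (Matrix.of fun l k => (A l k).coeff n) := by
      rw [Matrix.det_apply, Matrix.det_apply, Polynomial.finsetSum_coeff]
      refine sum_congr rfl fun σ _ => ?_
      have := Polynomial.coeff_prod_of_natDegree_le (s := univ) (fun i => A (σ i) i) n (by
        intro i _
        refine (aa_natDegree _ _ _).trans ?_
        simp only [ρ]; split_ifs <;> omega)
      rw [card_univ] at this
      rw [Polynomial.coeff_smul, this]
      rfl
    have h2 : (Matrix.of fun l k => (A l k).coeff n) = Matrix.diagonal fun l => (A l l).coeff n := by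
      ext l k
      by_cases hlk : l = k
      · subst hlk; simp
      · simp only [Matrix.of_apply, Matrix.diagonal_apply_ne _ hlk, A]
        rw [aa_coeff, if_neg]
        simp [ρ, Ne.symm hlk]
    rw [h1, h2, Matrix.det_diagonal, prod_ne_zero_iff]
    intro l _
    simp only [A, Matrix.of_apply, aa_coeff, ρ]
    simp only [if_true, lt_add_iff_pos_right, zero_lt_one, Nat.add_sub_cancel, Nat.sub_self]
    refine div_ne_zero ?_ (by exact_mod_cast n.factorial_ne_zero)
    rw [coeff_zero_eq_constantCoeff, EE, map_prod, prod_ne_zero_iff]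
    intro i hi
    rw [map_pow]
    refine pow_ne_zero _ ?_
    have : v l - v i ≠ 0 := sub_ne_zero.2 fun h => (mem_erase.1 hi).1 (hv h).symm
    simp [pinv, this]
  have hdvd : (Polynomial.X ^ (Fintype.card ι * n)) ∣ A.det := by
    rw [Polynomial.X_pow_dvd_iff]
    intro s hs
    let B : Matrix ι ι ℂ⟦X⟧ := A.map (Polynomial.coeToPowerSeries.ringHom)
    have hB : B.det = ((A.det : Polynomial ℂ) : ℂ⟦X⟧) := by
      have := RingHom.map_det (Polynomial.coeToPowerSeries.ringHom (R := ℂ)) A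
      rw [Polynomial.coeToPowerSeries.ringHom_apply] at this
      exact this.symm
    have h3 : B.mulVec (fun k => rescale (v k) (exp ℂ)) = fun l => RR v (ρ l) := by
      ext l : 1
      simp [Matrix.mulVec, dotProduct, RR, B, A]
    have h4 : B.det • (fun k => rescale (v k) (exp ℂ)) = B.adjugate.mulVec (fun l => RR v (ρ l)) := by
      rw [← h3, Matrix.mulVec_mulVec, Matrix.adjugate_mul, Matrix.smul_mulVec, Matrix.one_mulVec]
    obtain ⟨k⟩ := ‹Nonempty ι›
    have h5 := congrFun h4 k
    have h6 : (X : ℂ⟦X⟧) ^ (Fintype.card ι * n) ∣ B.det * rescale (v k) (exp ℂ) := by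
      have : B.det * rescale (v k) (exp ℂ) = B.adjugate.mulVec (fun l => RR v (ρ l)) k := h5
      rw [this]
      refine dvd_sum fun l _ => Dvd.dvd.mul_left ?_ _
      rw [X_pow_dvd_iff]
      intro s hs
      refine RR_vanish hv _ _ ?_
      simp only [ρ, sum_add_distrib]
      simp
      omega
    have hu : IsUnit (rescale (v k) (exp ℂ)) := by
      rw [isUnit_iff_constantCoeff, ← coeff_zero_eq_constantCoeff, coeff_rescale]
      simp
    have h7 := (hu.dvd_mul_right).1 h6
    rw [hB, X_pow_dvd_iff] at h7
    simpa using h7 s hs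
  have hdeg : A.det.natDegree ≤ Fintype.card ι * n := by
    rw [Matrix.det_apply]
    refine Polynomial.natDegree_sum_le_of_forall_le _ _ fun σ _ => ?_
    refine (Polynomial.natDegree_smul_le _ _).trans ?_
    refine (Polynomial.natDegree_prod_le _ _).trans ?_
    rw [← card_univ, ← smul_eq_mul]
    refine sum_le_card_nsmul _ _ _ fun i _ => ?_
    refine (aa_natDegree _ _ _).trans ?_
    simp only [ρ]; split_ifs <;> omega
  obtain ⟨c, hc⟩ := hdvd
  have hev : A.det.eval x ≠ 0 := by
    have hc0 : c ≠ 0 := by rintro rfl; simp [hc] at hcoef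
    have : c.natDegree = 0 := by
      rw [hc, Polynomial.natDegree_mul (pow_ne_zero _ Polynomial.X_ne_zero) hc0, Polynomial.natDegree_X_pow] at hdeg
      omega
    rw [Polynomial.eq_C_of_natDegree_eq_zero this] at hc hc0
    rw [hc]
    simp only [Polynomial.eval_mul, Polynomial.eval_pow, Polynomial.eval_X, Polynomial.eval_C]
    exact mul_ne_zero (pow_ne_zero _ hx) (by simpa using hc0)
  have hev2 : A.det.eval x = Matrix.det (A.map (Polynomial.eval x)) := by
    have := RingHom.map_det (Polynomial.evalRingHom x) A
    simpa using this
  rw [hev2] at hev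
  apply hev
  rw [← Matrix.exists_mulVec_eq_zero_iff]
  refine ⟨w, hw, ?_⟩
  ext l
  rw [Pi.zero_apply, ← hcon l]
  simp [Matrix.mulVec, dotProduct, A, ρ, mul_comm]


lemma hasSum_shift {𝕂 : Type*} [NormedField 𝕂] (j : ℕ) (c v x e : 𝕂)
    (he : HasSum (fun s : ℕ => (v * x) ^ s / (s.factorial : 𝕂)) e) :
    HasSum (fun s : ℕ => (if j ≤ s then c * (v ^ (s - j) / ((s - j).factorial : 𝕂)) else 0) * x ^ s)
      (c * x ^ j * e) := by
  have h := he.mul_left (c * x ^ j)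
  rw [← (add_left_injective j).hasSum_iff]
  · refine h.congr_fun ?_ |> fun h => h
    intro s
    simp only [Function.comp, le_add_iff_nonneg_left, zero_le, if_true, Nat.add_sub_cancel]
    rw [mul_pow, pow_add]; ring
  · intro s hs
    rw [if_neg, zero_mul]
    intro hj
    exact hs ⟨s - j, by simp; omega⟩

lemma pow_sub_pow_norm (a b : ℂ) (ha : ‖a‖ ≤ 5) (hb : ‖b‖ ≤ 5) (j : ℕ) :
    ‖a ^ j - b ^ j‖ ≤ j * 5 ^ j * ‖a - b‖ := by
  induction j with
  | zero => simp
  | succ j ih =>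
    have : a ^ (j+1) - b ^ (j+1) = a * (a ^ j - b ^ j) + (a - b) * b ^ j := by ring
    rw [this]
    refine (norm_add_le _ _).trans ?_
    rw [norm_mul, norm_mul, norm_pow]
    have h1 : ‖a‖ * ‖a^j - b^j‖ ≤ 5 * (j * 5 ^ j * ‖a - b‖) := by gcongr
    have h2 : ‖a - b‖ * ‖b‖ ^ j ≤ ‖a - b‖ * 5 ^ j := by gcongr
    have h3 : (0:ℝ) ≤ ‖a - b‖ * 5 ^ j := by positivity
    push_cast
    rw [pow_succ]
    nlinarith

lemma prod_nodes (m k : ℕ) (hk : k ≤ m) : ∏ i ∈ (range (m+1)).erase k, ((k:ℤ) - i) =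
    k.factorial * ((-1) ^ (m-k) * (m-k).factorial) := by
  induction m, hk using Nat.le_induction with
  | base =>
    rw [range_add_one, erase_insert (by simp)]
    simp only [Nat.sub_self, pow_zero, Nat.factorial_zero, Nat.cast_one, mul_one]
    rw [← prod_range_reflect, ← prod_range_add_one_eq_factorial]
    push_cast
    refine prod_congr rfl fun i hi => ?_
    have := mem_range.1 hi
    omega
  | succ m hm ih =>
    rw [range_add_one, erase_insert_of_ne (by omega), prod_insert (by simp), ih,
      Nat.sub_add_comm hm, Nat.factorial_succ, pow_succ]
    push_cast [Nat.cast_sub hm]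
    ring

lemma prod_nodes_fin (m : ℕ) (k : Fin (m+1)) : ∃ g : ℤ, (∏ i ∈ univ.erase k, ((k:ℤ) - (i:ℤ))) * g = m.factorial
    ∧ |g| ≤ 2 ^ m := by
  have hk : (k:ℕ) ≤ m := by omega
  refine ⟨(-1) ^ (m - k) * m.choose k, ?_, ?_⟩
  · have : ∏ i ∈ univ.erase k, ((k:ℤ) - (i:ℤ)) = ∏ i ∈ (range (m+1)).erase k, (((k:ℕ):ℤ) - i) := by
      refine prod_bij (fun i _ => (i:ℕ)) ?_ ?_ ?_ ?_
      · intro i hi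
        simp only [mem_erase, mem_univ, and_true, mem_range] at hi ⊢
        exact ⟨fun h => hi (Fin.ext h), i.2⟩
      · intro a _ b _ h
        exact Fin.ext h
      · intro b hb
        simp only [mem_erase, mem_range] at hb
        exact ⟨⟨b, hb.2⟩, by simp [Fin.ext_iff, hb.1], rfl⟩
      · intro i _; rfl
    rw [this, prod_nodes m k hk, ← Nat.choose_mul_factorial_mul_factorial hk]
    push_cast
    have : ((-1:ℤ) ^ (m - (k:ℕ))) * (-1) ^ (m - (k:ℕ)) = 1 := by rw [← mul_pow]; simp
    linear_combination ((k:ℕ).factorial * (m-(k:ℕ)).factorial * (m.choose k) : ℤ) * this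
  · rw [abs_mul, abs_pow]
    simp only [abs_neg, abs_one, one_pow, one_mul, Nat.abs_cast]
    exact_mod_cast Nat.choose_le_two_pow m k

/-- weighted truncated `ℓ¹` bound -/
def Bd (F : ℂ⟦X⟧) (K : ℝ) : Prop := ∀ T : ℕ, ∑ r ∈ range T, ‖coeff r F‖ / 2 ^ r ≤ K

lemma Bd.nonneg {F : ℂ⟦X⟧} {K : ℝ} (h : Bd F K) : 0 ≤ K := by simpa using h 0

lemma Bd.mul {F G : ℂ⟦X⟧} {K L : ℝ} (hF : Bd F K) (hG : Bd G L) : Bd (F * G) (K * L) := by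
  intro T
  calc ∑ r ∈ range T, ‖coeff r (F * G)‖ / 2 ^ r
      ≤ ∑ r ∈ range T, ∑ p ∈ antidiagonal r, (‖coeff p.1 F‖ / 2 ^ p.1) * (‖coeff p.2 G‖ / 2 ^ p.2) := by
        refine sum_le_sum fun r _ => ?_
        rw [coeff_mul, div_le_iff₀ (by positivity), sum_mul]
        refine (norm_sum_le _ _).trans (sum_le_sum fun p hp => ?_)
        rw [norm_mul, ← mem_antidiagonal.1 hp, pow_add]
        apply le_of_eq
        field_simp
    _ = ∑ p ∈ (range T).sigma (fun r => antidiagonal r), (‖coeff p.2.1 F‖ / 2 ^ p.2.1) * (‖coeff p.2.2 G‖ / 2 ^ p.2.2) := by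
        rw [sum_sigma]
    _ ≤ ∑ p ∈ range T ×ˢ range T, (‖coeff p.1 F‖ / 2 ^ p.1) * (‖coeff p.2 G‖ / 2 ^ p.2) := by
        have hinj : Set.InjOn (fun p : (_ : ℕ) × (ℕ × ℕ) => p.2)
            ((range T).sigma (fun r => antidiagonal r) : Finset ((_ : ℕ) × (ℕ × ℕ))) := by
          rintro ⟨a, p⟩ ha ⟨b, q⟩ hb h
          simp only [coe_sigma, Set.mem_sigma_iff, mem_coe, HasAntidiagonal.mem_antidiagonal] at ha hb h
          subst h
          rw [← ha.2, ← hb.2]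
        rw [← sum_image (f := fun p : ℕ × ℕ => (‖PowerSeries.coeff p.1 F‖ / 2 ^ p.1) *
          (‖PowerSeries.coeff p.2 G‖ / 2 ^ p.2)) hinj]
        refine sum_le_sum_of_subset_of_nonneg ?_ fun _ _ _ => by positivity
        intro p hp
        simp only [mem_image, mem_sigma, mem_range, HasAntidiagonal.mem_antidiagonal, mem_product] at hp ⊢
        obtain ⟨q, hq, rfl⟩ := hp
        omega
    _ = (∑ r ∈ range T, ‖coeff r F‖ / 2 ^ r) * (∑ r ∈ range T, ‖coeff r G‖ / 2 ^ r) := by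
        rw [sum_mul_sum, sum_product]
    _ ≤ K * L := mul_le_mul (hF T) (hG T) (sum_nonneg fun _ _ => by positivity) hF.nonneg

lemma Bd.one : Bd 1 1 := by
  intro T
  rcases T with _ | T
  · simp
  rw [sum_range_succ']
  simp [coeff_one]

lemma Bd.pow {F : ℂ⟦X⟧} {K : ℝ} (hF : Bd F K) (e : ℕ) : Bd (F ^ e) (K ^ e) := by
  induction e with
  | zero => simpa using Bd.one
  | succ e ih => rw [pow_succ, pow_succ]; exact ih.mul hF

lemma Bd.prod {ι : Type*} (s : Finset ι) (F : ι → ℂ⟦X⟧) (K : ι → ℝ) (h : ∀ i ∈ s, Bd (F i) (K i)) :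
    Bd (∏ i ∈ s, F i) (∏ i ∈ s, K i) := by
  classical
  induction s using Finset.induction_on with
  | empty => simpa using Bd.one
  | insert a s ha ih =>
    rw [prod_insert ha, prod_insert ha]
    exact (h a (by simp)).mul (ih fun i hi => h i (by simp [hi]))

lemma Bd.coeff {F : ℂ⟦X⟧} {K : ℝ} (hF : Bd F K) (r : ℕ) : ‖coeff r F‖ ≤ K * 2 ^ r := by
  have h1 : ‖PowerSeries.coeff r F‖ / 2 ^ r ≤ ∑ r ∈ range (r+1), ‖PowerSeries.coeff r F‖ / 2 ^ r :=
    single_le_sum (f := fun r => ‖PowerSeries.coeff r F‖ / 2 ^ r) (fun _ _ => by positivity) (by simp)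
  rw [← div_le_iff₀ (by positivity)]
  exact h1.trans (hF _)

/-- power series with integral coefficients after rescaling -/
noncomputable def Sd (d : ℕ) : Subring ℂ⟦X⟧ :=
  (PowerSeries.map (Int.castRingHom ℂ)).range.comap (rescale (d : ℂ))

lemma Sd_coeff {d : ℕ} {F : ℂ⟦X⟧} (hF : F ∈ Sd d) (r : ℕ) : ∃ z : ℤ, (d : ℂ) ^ r * coeff r F = z := by
  obtain ⟨G, hG⟩ := hF
  refine ⟨coeff r G, ?_⟩
  have := congrArg (coeff r) hG
  rw [coeff_map, coeff_rescale] at this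
  simpa using this.symm

lemma psi_bound (m : ℕ) : (Nat.lcmUpto m : ℝ) ≤ 256 ^ m := by
  have h := Chebyshev.psi_le_const_mul_self (x := m) (by positivity)
  rw [Chebyshev.psi_eq_log_lcmUpto] at h
  have hpos : (0:ℝ) < Nat.lcmUpto m := by exact_mod_cast Nat.lcmUpto_pos m
  rw [← Real.log_le_log_iff hpos (by positivity), Real.log_pow]
  refine h.trans ?_
  rw [mul_comm]
  gcongr
  have h4 : (4:ℝ) ≤ Real.log 64 := by
    rw [Real.le_log_iff_exp_le (by norm_num), show (4:ℝ) = (4:ℕ) * 1 by norm_num, Real.exp_nat_mul]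
    have := Real.exp_one_lt_d9
    calc Real.exp 1 ^ 4 ≤ (2.72:ℝ) ^ 4 := by gcongr; linarith
      _ ≤ 64 := by norm_num
  calc Real.log 4 + 4 ≤ Real.log 4 + Real.log 64 := by linarith
    _ = Real.log 256 := by rw [← Real.log_mul (by norm_num) (by norm_num)]; norm_num


lemma q_mem (d : ℕ) (b : ℤ) (hb : b ≠ 0) (hbd : b ∣ (d:ℤ)) : C (b:ℂ) * pinv b ∈ Sd d := by
  obtain ⟨e, he⟩ := hbd
  refine ⟨PowerSeries.mk fun r => (-1)^r * e^r, ?_⟩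
  ext r
  rw [coeff_map, coeff_mk, coeff_rescale, coeff_C_mul, pinv, coeff_mk]
  have hd : (d:ℂ) = b * e := by exact_mod_cast he
  have hb' : (b:ℂ) ≠ 0 := by exact_mod_cast hb
  rw [hd]
  simp only [map_mul, map_pow, map_neg, map_one, eq_intCast]
  field_simp
  ring

lemma q_Bd (b : ℤ) (hb : b ≠ 0) : Bd (C (b:ℂ) * pinv b) 2 := by
  intro T
  refine le_trans (sum_le_sum fun r _ => ?_) (sum_geometric_two_le T)
  have hb1 : (1:ℝ) ≤ ‖(b:ℂ)‖ := by
    rw [Complex.norm_intCast]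
    exact_mod_cast Int.one_le_abs hb
  rw [coeff_C_mul, pinv, coeff_mk, one_div, inv_pow, ← one_div]
  gcongr
  rw [norm_mul, norm_div, norm_pow, norm_pow]
  simp only [norm_neg, norm_one, one_pow]
  rw [mul_one_div, div_le_one (by positivity)]
  exact le_self_pow₀ hb1 (by omega)

noncomputable def nd (m : ℕ) : Fin (m+1) → ℂ := fun k => ((k:ℕ):ℂ)

lemma nd_inj (m : ℕ) : Function.Injective (nd m) := by
  intro a b h
  simp only [nd, Nat.cast_inj] at h
  exact Fin.ext h

def rh {m : ℕ} (n : ℕ) (l : Fin (m+1)) : Fin (m+1) → ℕ := fun i => n + (if i = l then 1 else 0)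

lemma sub_dvd_lcm (m : ℕ) (k i : Fin (m+1)) (h : i ≠ k) : ((k:ℤ) - (i:ℤ)) ∣ (Nat.lcmUpto m : ℤ) := by
  have h0 : (k:ℤ) - (i:ℤ) ≠ 0 := by
    intro h1; apply h; ext; omega
  rw [← Int.natAbs_dvd, Int.natCast_dvd_natCast]
  have hmem : ((k:ℤ) - (i:ℤ)).natAbs ∈ Icc 1 m := by
    rw [mem_Icc]
    have hk := k.2
    have hi := i.2
    omega
  exact dvd_lcm (f := id) hmem

lemma EE_bound (m n : ℕ) (l k : Fin (m+1)) : ∃ F : ℂ⟦X⟧, F ∈ Sd (Nat.lcmUpto m) ∧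
    Bd F (2 ^ (m * n) * Nat.lcmUpto m * 2 ^ (m * n + 1)) ∧
    C (((m.factorial : ℂ)) ^ n * (Nat.lcmUpto m : ℂ)) * EE (nd m) (rh n l) k = F := by
  set d := Nat.lcmUpto m with hd
  have hdpos : 0 < d := Nat.lcmUpto_pos m
  let b : Fin (m+1) → ℤ := fun i => (k:ℤ) - (i:ℤ)
  have hb0 : ∀ i ∈ univ.erase k, b i ≠ 0 := by
    intro i hi h1
    apply (mem_erase.1 hi).1
    ext; simp only [b] at h1; omega
  have hbd : ∀ i ∈ univ.erase k, b i ∣ (d:ℤ) := fun i hi => sub_dvd_lcm m k i (mem_erase.1 hi).1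
  obtain ⟨g1, hg1, hg1b⟩ := prod_nodes_fin m k
  have h2 : ∃ g2 : ℤ, (∏ i ∈ univ.erase k, b i ^ (if i = l then 1 else 0)) * g2 = d ∧ |g2| ≤ d := by
    by_cases hl : l = k
    · refine ⟨d, ?_, by simp⟩
      rw [prod_eq_one, one_mul]
      intro i hi
      rw [if_neg, pow_zero]
      rw [hl]; exact (mem_erase.1 hi).1
    · have hl' : l ∈ univ.erase k := by simp [hl]
      obtain ⟨g2, hg2⟩ := hbd l hl'
      refine ⟨g2, ?_, ?_⟩
      · rw [prod_eq_single l]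
        · simp [← hg2]
        · intro i _ hi; simp [hi]
        · intro h; exact absurd hl' h
      · refine Int.le_of_dvd (by exact_mod_cast hdpos) ?_
        rw [abs_dvd]
        exact ⟨b l, by rw [hg2]; ring⟩
  obtain ⟨g2, hg2, hg2b⟩ := h2
  let P : ℂ⟦X⟧ := ∏ i ∈ univ.erase k, (C (b i : ℂ) * pinv (b i)) ^ (rh n l i)
  have hP : P = C (∏ i ∈ univ.erase k, (b i : ℂ) ^ (rh n l i)) * EE (nd m) (rh n l) k := by
    simp only [P, EE, mul_pow, prod_mul_distrib, map_prod, map_pow]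
    congr 1
    refine prod_congr rfl fun i _ => ?_
    simp [b, nd]
  have hg : (∏ i ∈ univ.erase k, (b i) ^ (rh n l i)) * (g1 ^ n * g2) = (m.factorial:ℤ) ^ n * d := by
    simp only [rh, pow_add, prod_mul_distrib]
    rw [prod_pow, ← hg1, mul_pow]
    linear_combination (∏ i ∈ univ.erase k, b i) ^ n * g1 ^ n * hg2
  refine ⟨C ((g1 ^ n * g2 : ℤ) : ℂ) * P, ?_, ?_, ?_⟩
  · refine mul_mem ?_ (prod_mem fun i hi => pow_mem (q_mem _ _ (hb0 i hi) (hbd i hi)) _)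
    have : C ((g1 ^ n * g2 : ℤ) : ℂ) = ((g1 ^ n * g2 : ℤ) : ℂ⟦X⟧) := map_intCast _ _
    rw [this]
    exact intCast_mem _ _
  · have hB : Bd P (2 ^ (m * n + 1)) := by
      have := Bd.prod (univ.erase k) (fun i => (C (b i : ℂ) * pinv (b i)) ^ (rh n l i)) (fun i => 2 ^ (rh n l i))
        (fun i hi => (q_Bd _ (hb0 i hi)).pow _)
      intro T
      refine (this T).trans ?_
      rw [prod_pow_eq_pow_sum]
      refine pow_le_pow_right₀ (by norm_num) ?_
      simp only [rh, sum_add_distrib]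
      rw [sum_const, card_erase_of_mem (mem_univ _), card_univ, Fintype.card_fin, smul_eq_mul, Nat.add_sub_cancel]
      gcongr
      rw [sum_ite_eq']
      split_ifs <;> simp
    have hC : Bd (C ((g1 ^ n * g2 : ℤ) : ℂ)) (2 ^ (m * n) * d) := by
      intro T
      have h3 : ‖((g1 ^ n * g2 : ℤ) : ℂ)‖ ≤ 2 ^ (m * n) * d := by
        rw [Complex.norm_intCast]
        have : |g1 ^ n * g2| ≤ 2 ^ (m * n) * d := by
          rw [abs_mul, abs_pow, pow_mul]
          gcongr
        exact_mod_cast this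
      rcases T with _ | T
      · simp
      rw [sum_range_succ', sum_eq_zero]
      · rw [coeff_C, if_pos rfl, zero_add, pow_zero, div_one]
        exact h3
      · intro i _
        rw [coeff_C, if_neg (by omega)]
        simp
    exact hC.mul hB
  · rw [hP, ← mul_assoc, ← map_mul]
    congr 2
    have : (((∏ i ∈ univ.erase k, (b i) ^ (rh n l i)) * (g1 ^ n * g2) : ℤ) : ℂ) = ((m.factorial:ℤ) ^ n * d : ℤ) := by
      rw [hg]
    push_cast at this ⊢
    rw [← this]; ring

/-- common denominator -/
noncomputable def DD (m n : ℕ) : ℂ :=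
  (n.factorial : ℂ) * (Nat.lcmUpto m : ℂ) ^ n * ((m.factorial : ℂ) ^ n * (Nat.lcmUpto m : ℂ))

noncomputable def HH (m n : ℕ) : ℝ :=
  (n.factorial : ℝ) * (Nat.lcmUpto m : ℝ) ^ n * (2 ^ (m * n) * Nat.lcmUpto m * 2 ^ (m * n + 1) * 2 ^ n)

lemma HH_nonneg (m n : ℕ) : 0 ≤ HH m n := by unfold HH; positivity

lemma DD_aa (m n : ℕ) (l k : Fin (m+1)) (j : ℕ) :
    (∃ z : ℤ, DD m n * (aa (nd m) (rh n l) k).coeff j = z) ∧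
    ‖DD m n * (aa (nd m) (rh n l) k).coeff j‖ ≤ HH m n := by
  rw [aa_coeff]
  split_ifs with hj
  swap
  · exact ⟨⟨0, by simp⟩, by simpa using HH_nonneg m n⟩
  obtain ⟨F, hF, hB, hE⟩ := EE_bound m n l k
  have hrk : rh n l k ≤ n + 1 := by unfold rh; split_ifs <;> omega
  have hjn : j ≤ n := by omega
  set r := rh n l k - 1 - j with hr
  have hrn : r ≤ n := by omega
  have hc : ((m.factorial : ℂ) ^ n * (Nat.lcmUpto m : ℂ)) * coeff r (EE (nd m) (rh n l) k) = coeff r F := by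
    rw [← hE, coeff_C_mul]
  obtain ⟨e, he⟩ := Nat.factorial_dvd_factorial hjn
  have hjf : (j.factorial : ℂ) ≠ 0 := by exact_mod_cast j.factorial_ne_zero
  have key : DD m n * (coeff r (EE (nd m) (rh n l) k) / (j.factorial : ℂ)) =
      e * (Nat.lcmUpto m : ℂ) ^ n * coeff r F := by
    rw [← hc, DD, he]
    push_cast
    field_simp
  rw [key]
  constructor
  · obtain ⟨z, hz⟩ := Sd_coeff hF r
    refine ⟨e * (Nat.lcmUpto m) ^ (n - r) * z, ?_⟩
    push_cast
    have : (Nat.lcmUpto m : ℂ) ^ n = (Nat.lcmUpto m : ℂ) ^ (n - r) * (Nat.lcmUpto m : ℂ) ^ r := by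
      rw [← pow_add, Nat.sub_add_cancel hrn]
    rw [← hz, this]
    ring
  · rw [norm_mul, norm_mul, norm_pow, Complex.norm_natCast, Complex.norm_natCast]
    unfold HH
    have h1 := hB.coeff r
    have he2 : e ≤ n.factorial := by
      rw [he]; exact Nat.le_mul_of_pos_left _ j.factorial_pos
    have h2 : (2:ℝ) ^ r ≤ 2 ^ n := pow_le_pow_right₀ (by norm_num) hrn
    refine mul_le_mul ?_ (h1.trans ?_) (norm_nonneg _) (by positivity)
    · gcongr
    · gcongr


lemma rh_le {m : ℕ} (n : ℕ) (l k : Fin (m+1)) : rh n l k ≤ n + 1 := by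
  unfold rh; split_ifs <;> omega

lemma aa_sum (m n : ℕ) (l k : Fin (m+1)) : aa (nd m) (rh n l) k =
    ∑ j ∈ range (n+1), Polynomial.monomial j ((aa (nd m) (rh n l) k).coeff j) := by
  refine Polynomial.as_sum_range' _ _ ?_
  have h1 := aa_natDegree (nd m) (rh n l) k
  have := rh_le n l k
  omega

lemma aa_eval (m n : ℕ) (l k : Fin (m+1)) (x : ℂ) : (aa (nd m) (rh n l) k).eval x =
    ∑ j ∈ range (n+1), (aa (nd m) (rh n l) k).coeff j * x ^ j := by
  conv_lhs => rw [aa_sum]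
  simp [Polynomial.eval_finsetSum]

lemma RR_coeff (m n : ℕ) (l : Fin (m+1)) (s : ℕ) : coeff s (RR (nd m) (rh n l)) =
    ∑ k, ∑ j ∈ range (n+1), (if j ≤ s then (aa (nd m) (rh n l) k).coeff j *
      (nd m k ^ (s - j) / ((s - j).factorial : ℂ)) else 0) := by
  unfold RR
  rw [map_sum]
  refine sum_congr rfl fun k _ => ?_
  have hc : ((aa (nd m) (rh n l) k : Polynomial ℂ) : ℂ⟦X⟧) = ∑ j ∈ range (n+1),
      ((Polynomial.monomial j ((aa (nd m) (rh n l) k).coeff j) : Polynomial ℂ) : ℂ⟦X⟧) := by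
    conv_lhs => rw [aa_sum]
    simp only [← Polynomial.coeToPowerSeries.ringHom_apply]
    exact map_sum (Polynomial.coeToPowerSeries.ringHom (R := ℂ)) _ _
  rw [hc, sum_mul, map_sum]
  simp only [coeff_monomial_mul_exp]

lemma RR_est (m n : ℕ) (l : Fin (m+1)) (x : ℂ) (T : ℝ) (hT : 1 ≤ T) (hx : ‖x‖ ≤ T) :
    ‖∑ k, DD m n * (aa (nd m) (rh n l) k).eval x * Complex.exp (nd m k * x)‖ ≤
      (‖x‖ / T) ^ ((m+1) * n) * ((m+1) * ((n+1) * (HH m n * T ^ n * Real.exp (m * T)))) := by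
  set c : Fin (m+1) → ℕ → ℂ := fun k j => DD m n * (aa (nd m) (rh n l) k).coeff j with hcdef
  have hT0 : 0 < T := by linarith
  have h1 : HasSum (fun s : ℕ => ∑ k, ∑ j ∈ range (n+1), (if j ≤ s then c k j *
      (nd m k ^ (s - j) / ((s - j).factorial : ℂ)) else 0) * x ^ s)
      (∑ k, ∑ j ∈ range (n+1), c k j * x ^ j * Complex.exp (nd m k * x)) := by
    refine hasSum_sum fun k _ => hasSum_sum fun j _ => hasSum_shift j _ _ _ _ ?_
    rw [Complex.exp_eq_exp_ℂ]
    exact NormedSpace.expSeries_div_hasSum_exp _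
  have h2 : HasSum (fun s : ℕ => ∑ k, ∑ j ∈ range (n+1), (if j ≤ s then ‖c k j‖ *
      (‖nd m k‖ ^ (s - j) / ((s - j).factorial : ℝ)) else 0) * T ^ s)
      (∑ k, ∑ j ∈ range (n+1), ‖c k j‖ * T ^ j * Real.exp (‖nd m k‖ * T)) := by
    refine hasSum_sum fun k _ => hasSum_sum fun j _ => hasSum_shift j _ _ _ _ ?_
    rw [Real.exp_eq_exp_ℝ]
    exact NormedSpace.expSeries_div_hasSum_exp _
  have h3 := HasSum.norm_le_of_bounded h1 (h2.mul_left ((‖x‖ / T) ^ ((m+1) * n))) (by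
    intro s
    have e1 : ∑ k, ∑ j ∈ range (n+1), (if j ≤ s then c k j *
      (nd m k ^ (s - j) / ((s - j).factorial : ℂ)) else 0) * x ^ s =
      DD m n * coeff s (RR (nd m) (rh n l)) * x ^ s := by
      rw [RR_coeff, mul_sum, sum_mul]
      refine sum_congr rfl fun k _ => ?_
      rw [mul_sum, sum_mul]
      refine sum_congr rfl fun j _ => ?_
      split_ifs <;> simp [hcdef, mul_assoc]
    by_cases hs : s < (m+1) * n
    · rw [e1, RR_vanish (nd_inj m) _ _ (by simp [rh, sum_add_distrib]; omega)]
      simp only [mul_zero, zero_mul, norm_zero]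
      refine mul_nonneg (by positivity) (sum_nonneg fun k _ => sum_nonneg fun j _ => ?_)
      split_ifs
      · positivity
      · simp
    · push Not at hs
      have hxs : ‖x‖ ^ s ≤ (‖x‖ / T) ^ ((m+1) * n) * T ^ s := by
        have : ‖x‖ ^ s = (‖x‖ / T) ^ s * T ^ s := by rw [div_pow]; field_simp
        rw [this]
        gcongr ?_ * _
        exact pow_le_pow_of_le_one (by positivity) ((div_le_one hT0).2 hx) hs
      rw [mul_sum]
      refine (norm_sum_le _ _).trans (sum_le_sum fun k _ => ?_)
      rw [mul_sum]
      refine (norm_sum_le _ _).trans (sum_le_sum fun j _ => ?_)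
      split_ifs
      · rw [norm_mul, norm_mul, norm_div, norm_pow, norm_pow, Complex.norm_natCast, mul_left_comm]
        gcongr
      · simp)
  have e2 : ∑ k, DD m n * (aa (nd m) (rh n l) k).eval x * Complex.exp (nd m k * x) =
      ∑ k, ∑ j ∈ range (n+1), c k j * x ^ j * Complex.exp (nd m k * x) := by
    refine sum_congr rfl fun k _ => ?_
    rw [aa_eval, mul_sum, sum_mul]
    refine sum_congr rfl fun j _ => ?_
    simp [hcdef, mul_assoc]
  rw [e2]
  refine h3.trans ?_
  gcongr
  have h4 : ∀ k : Fin (m+1), ∑ j ∈ range (n+1), ‖c k j‖ * T ^ j * Real.exp (‖nd m k‖ * T) ≤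
      (n+1) * (HH m n * T ^ n * Real.exp (m * T)) := by
    intro k
    have := sum_le_card_nsmul (range (n+1)) (fun j => ‖c k j‖ * T ^ j * Real.exp (‖nd m k‖ * T))
      (HH m n * T ^ n * Real.exp (m * T)) (by
        intro j hj
        have hj' : j ≤ n := by have := mem_range.1 hj; omega
        have a1 : ‖c k j‖ ≤ HH m n := (DD_aa m n l k j).2
        have a2 : T ^ j ≤ T ^ n := pow_le_pow_right₀ hT hj'
        have a3 : ‖nd m k‖ ≤ m := by
          simp only [nd, Complex.norm_natCast]
          exact_mod_cast (by omega : (k:ℕ) ≤ m)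
        have a4 := HH_nonneg m n
        gcongr)
    simpa using this
  have := sum_le_card_nsmul univ _ _ fun k _ => h4 k
  simpa using this

lemma gauss_norm (z : GaussianInt) (hz : z ≠ 0) : 1 ≤ ‖GaussianInt.toComplex z‖ := by
  have h1 : (1:ℝ) ≤ Complex.normSq (GaussianInt.toComplex z) := by
    rw [← GaussianInt.intCast_real_norm]
    exact_mod_cast GaussianInt.norm_pos.2 hz
  rw [Complex.normSq_eq_norm_sq] at h1
  nlinarith [norm_nonneg (GaussianInt.toComplex z)]

/-- key inequality -/
lemma key_ineq (m n : ℕ) (hn : 4 ≤ n) (p : ℤ) (q : ℕ) (hq : 0 < q) (hp : p ≠ 0) (h5 : |(p:ℝ) / q| ≤ 5) :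
    1 ≤ (q:ℝ) ^ n * ((Real.pi / n) ^ ((m+1) * n) * ((m+1) * ((n+1) * (HH m n * n ^ n * Real.exp (m * n))))
      + (m+1) * ((n+1) * (HH m n * (n * 5 ^ n))) * |Real.pi - p / q|) := by
  have hq' : (q:ℂ) ≠ 0 := by exact_mod_cast hq.ne'
  set y : ℂ := ((p:ℂ) / q) * Complex.I with hy
  have hy0 : y ≠ 0 := mul_ne_zero (div_ne_zero (by exact_mod_cast hp) hq') Complex.I_ne_zero
  set x : ℂ := Real.pi * Complex.I with hxdef
  obtain ⟨l, hl⟩ := det_ne (nd_inj m) n y hy0 (fun k => (-1) ^ (k:ℕ)) (by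
    intro h
    have := congrFun h 0
    simp at this)
  change ∑ k : Fin (m+1), (-1) ^ (k:ℕ) * (aa (nd m) (rh n l) k).eval y ≠ 0 at hl
  choose z hz using fun k j => (DD_aa m n l k j).1
  have hHH := HH_nonneg m n
  have hD0 : DD m n ≠ 0 := by
    have h1 : (Nat.lcmUpto m : ℂ) ≠ 0 := by exact_mod_cast (Nat.lcmUpto_pos m).ne'
    have h2 : (m.factorial : ℂ) ≠ 0 := by exact_mod_cast m.factorial_ne_zero
    have h3 : (n.factorial : ℂ) ≠ 0 := by exact_mod_cast n.factorial_ne_zero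
    unfold DD
    positivity
  set W : ℂ → ℂ := fun x => ∑ k : Fin (m+1), (-1) ^ (k:ℕ) * (DD m n * (aa (nd m) (rh n l) k).eval x) with hW
  have hWeval : ∀ x, W x = ∑ k : Fin (m+1), ∑ j ∈ range (n+1), (-1) ^ (k:ℕ) * ((z k j : ℂ) * x ^ j) := by
    intro x
    refine sum_congr rfl fun k _ => ?_
    rw [aa_eval, mul_sum, mul_sum]
    refine sum_congr rfl fun j _ => ?_
    rw [← hz]; ring
  have hWy : W y ≠ 0 := by
    have : W y = DD m n * ∑ k : Fin (m+1), (-1) ^ (k:ℕ) * (aa (nd m) (rh n l) k).eval y := by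
      rw [hW, mul_sum]
      refine sum_congr rfl fun k _ => ?_
      ring
    rw [this]
    exact mul_ne_zero hD0 hl
  -- lower bound
  have hlow : 1 ≤ (q:ℝ) ^ n * ‖W y‖ := by
    let G : GaussianInt := ∑ k : Fin (m+1), ∑ j ∈ range (n+1),
      (-1) ^ (k:ℕ) * ((z k j : GaussianInt) * ((p:GaussianInt) ^ j * (⟨0, 1⟩ : GaussianInt) ^ j * (q : GaussianInt) ^ (n - j)))
    have hI : GaussianInt.toComplex (⟨0, 1⟩ : GaussianInt) = Complex.I := by
      simp [GaussianInt.toComplex_def₂, Complex.ext_iff]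
    have hG : GaussianInt.toComplex G = (q:ℂ) ^ n * W y := by
      rw [hWeval, mul_sum]
      simp only [G, map_sum]
      refine sum_congr rfl fun k _ => ?_
      rw [mul_sum]
      refine sum_congr rfl fun j hj => ?_
      have hj' : j ≤ n := by have := mem_range.1 hj; omega
      simp only [map_mul, map_pow, map_neg, map_one, map_intCast, map_natCast, hI]
      have : (q:ℂ) ^ n = (q:ℂ) ^ (n - j) * (q:ℂ) ^ j := by rw [← pow_add, Nat.sub_add_cancel hj']
      rw [this, hy, mul_pow, div_pow]
      field_simp
    have hG0 : G ≠ 0 := by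
      intro h
      rw [h, map_zero] at hG
      exact (mul_ne_zero (pow_ne_zero _ hq') hWy) hG.symm
    have := gauss_norm G hG0
    rwa [hG, norm_mul, norm_pow, Complex.norm_natCast] at this
  -- upper bound at pi
  have hnx : ‖x‖ = Real.pi := by
    rw [hxdef, norm_mul, Complex.norm_I, mul_one, Complex.norm_real, Real.norm_of_nonneg Real.pi_pos.le]
  have hn4 : (4:ℝ) ≤ n := by exact_mod_cast hn
  have hWx : ‖W x‖ ≤ (Real.pi / n) ^ ((m+1) * n) * ((m+1) * ((n+1) * (HH m n * n ^ n * Real.exp (m * n)))) := by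
    have h := RR_est m n l x n (by linarith) (by rw [hnx]; linarith [Real.pi_le_four])
    rw [hnx] at h
    refine le_trans (le_of_eq ?_) h
    congr 1
    refine sum_congr rfl fun k _ => ?_
    have : Complex.exp (nd m k * x) = (-1) ^ (k:ℕ) := by
      rw [nd, hxdef, Complex.exp_nat_mul, Complex.exp_pi_mul_I]
    rw [this]; ring
  have hny : ‖y‖ ≤ 5 := by
    rw [hy, norm_mul, Complex.norm_I, mul_one]
    have : ((p:ℂ) / q) = (((p:ℝ) / q : ℝ) : ℂ) := by push_cast; rfl
    rw [this, Complex.norm_real]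
    exact h5
  have hxy : ‖x - y‖ = |Real.pi - p / q| := by
    have : x - y = ((Real.pi - p / q : ℝ) : ℂ) * Complex.I := by
      rw [hxdef, hy]; push_cast; ring
    rw [this, norm_mul, Complex.norm_I, mul_one, Complex.norm_real, Real.norm_eq_abs]
  have hdiff : ‖W x - W y‖ ≤ (m+1) * ((n+1) * (HH m n * (n * 5 ^ n))) * |Real.pi - p / q| := by
    rw [hWeval, hWeval, ← sum_sub_distrib]
    have h4 : ∀ k : Fin (m+1), ‖∑ j ∈ range (n+1), (-1) ^ (k:ℕ) * ((z k j : ℂ) * x ^ j) -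
        ∑ j ∈ range (n+1), (-1) ^ (k:ℕ) * ((z k j : ℂ) * y ^ j)‖ ≤
        (n+1) * (HH m n * (n * 5 ^ n * |Real.pi - p / q|)) := by
      intro k
      rw [← sum_sub_distrib]
      refine (norm_sum_le _ _).trans ?_
      have := sum_le_card_nsmul (range (n+1)) (fun j => ‖(-1) ^ (k:ℕ) * ((z k j : ℂ) * x ^ j) -
        (-1) ^ (k:ℕ) * ((z k j : ℂ) * y ^ j)‖) (HH m n * (n * 5 ^ n * |Real.pi - p / q|)) (by
          intro j hj
          have hj' : j ≤ n := by have := mem_range.1 hj; omega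
          have a1 : ‖(z k j : ℂ)‖ ≤ HH m n := by rw [← hz]; exact (DD_aa m n l k j).2
          have a2 := pow_sub_pow_norm x y (by rw [hnx]; linarith [Real.pi_le_four]) hny j
          have a3 : (-1) ^ (k:ℕ) * ((z k j : ℂ) * x ^ j) - (-1) ^ (k:ℕ) * ((z k j : ℂ) * y ^ j) =
            (-1) ^ (k:ℕ) * ((z k j : ℂ) * (x ^ j - y ^ j)) := by ring
          rw [a3, norm_mul, norm_mul, norm_pow, norm_neg, norm_one, one_pow, one_mul]
          refine mul_le_mul a1 (a2.trans ?_) (norm_nonneg _) hHH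
          rw [hxy]
          have a4 : (5:ℝ) ^ j ≤ 5 ^ n := pow_le_pow_right₀ (by norm_num) hj'
          gcongr)
      simpa using this
    refine (norm_sum_le _ _).trans ?_
    have := sum_le_card_nsmul univ _ _ fun k _ => h4 k
    refine this.trans (le_of_eq ?_)
    simp
    ring
  refine hlow.trans ?_
  gcongr
  calc ‖W y‖ = ‖W x - (W x - W y)‖ := by congr 1; ring
    _ ≤ ‖W x‖ + ‖W x - W y‖ := norm_sub_le _ _
    _ ≤ _ := add_le_add hWx hdiff


lemma HH_le (m n : ℕ) : HH m n ≤ (n.factorial * 2 ^ (n + 1)) * ((256 ^ (n + 1) * 4 ^ n) ^ m) := by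
  have hd := psi_bound m
  have h1 : (Nat.lcmUpto m : ℝ) ^ (n + 1) ≤ (256 ^ (n + 1)) ^ m := by
    rw [← pow_mul, mul_comm, pow_mul]; gcongr
  have h2 : (4:ℝ) ^ n = 2 ^ n * 2 ^ n := by rw [← mul_pow]; norm_num
  have h3 : HH m n = (n.factorial * 2 ^ (n + 1)) * ((Nat.lcmUpto m : ℝ) ^ (n + 1) * (4 ^ n) ^ m) := by
    unfold HH
    rw [h2, mul_pow, ← pow_mul, mul_comm n m]
    ring
  rw [h3, mul_pow]
  gcongr

lemma succ_le_two_pow (m : ℕ) : ((m:ℝ) + 1) ≤ 2 ^ m := by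
  exact_mod_cast (Nat.lt_two_pow_self (n := m))

lemma measure_ineq : ∃ n b : ℕ, ∃ K : ℝ, 1 ≤ K ∧ ∀ (m : ℕ) (p : ℤ) (q : ℕ), 0 < q → p ≠ 0 → |(p:ℝ) / q| ≤ 5 →
    1 ≤ (q:ℝ) ^ n * (K * (1 / 2 ^ m) + K * (2 ^ m) ^ b * |Real.pi - p / q|) := by
  obtain ⟨n, hn⟩ : ∃ n : ℕ, 12582912 ≤ n := ⟨_, le_rfl⟩
  have hnR : (12582912:ℝ) ≤ n := by exact_mod_cast hn
  have hn0 : (0:ℝ) < n := by linarith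
  have hf1 : (1:ℝ) ≤ n.factorial := by exact_mod_cast n.factorial_pos
  set K1 : ℝ := (n+1) * ((n.factorial * 2 ^ (n+1)) * n ^ n) with hK1
  set K2 : ℝ := (n+1) * ((n.factorial * 2 ^ (n+1)) * (n * 5 ^ n)) with hK2
  have hK1p : 0 ≤ K1 := by positivity
  have hK2p : 0 ≤ K2 := by positivity
  refine ⟨n, 10 * n + 9, K1 + K2 + 1, by linarith, ?_⟩
  intro m p q hq hp h5
  refine (key_ineq m n (by omega) p q hq hp h5).trans ?_
  have hH := HH_le m n
  have hH0 := HH_nonneg m n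
  have hm := succ_le_two_pow m
  have hA : (Real.pi / n) ^ ((m+1) * n) * ((m+1) * ((n+1) * (HH m n * n ^ n * Real.exp (m * n)))) ≤
      K1 * (1 / 2 ^ m) := by
    have a1 : (Real.pi / n) ^ ((m+1) * n) ≤ ((4 / n : ℝ) ^ n) ^ m := by
      have b1 : Real.pi / n ≤ 1 := by rw [div_le_one hn0]; linarith [Real.pi_le_four]
      have b2 : 0 ≤ Real.pi / n := by positivity
      calc (Real.pi / n) ^ ((m+1) * n) ≤ (Real.pi / n) ^ (n * m) :=
            pow_le_pow_of_le_one b2 b1 (by nlinarith)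
        _ ≤ (4 / n : ℝ) ^ (n * m) := by gcongr; exact Real.pi_le_four
        _ = _ := by rw [pow_mul]
    have a2 : Real.exp (m * n) ≤ ((3:ℝ) ^ n) ^ m := by
      rw [mul_comm, Real.exp_mul, Real.rpow_natCast]
      gcongr
      rw [show (n:ℝ) = n * 1 by ring, Real.exp_nat_mul]
      gcongr
      linarith [Real.exp_one_lt_d9]
    have a3 : (4 / n : ℝ) ^ n * (3 ^ n * (256 ^ (n+1) * 4 ^ n)) ≤ 1 / 4 := by
      have c1 : (256:ℝ) ^ (n+1) ≤ 256 ^ n * 256 ^ n := by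
        rw [← pow_add]; exact pow_le_pow_right₀ (by norm_num) (by omega)
      calc (4 / n : ℝ) ^ n * (3 ^ n * (256 ^ (n+1) * 4 ^ n))
          ≤ (4 / n : ℝ) ^ n * (3 ^ n * ((256 ^ n * 256 ^ n) * 4 ^ n)) := by gcongr
        _ = (4 / n * (3 * ((256 * 256) * 4)) : ℝ) ^ n := by simp only [mul_pow]
        _ ≤ (1 / 4 : ℝ) ^ n := by
            gcongr
            rw [div_mul_eq_mul_div, div_le_iff₀ hn0]
            linarith
        _ ≤ (1 / 4 : ℝ) ^ 1 := pow_le_pow_of_le_one (by norm_num) (by norm_num) (by omega)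
        _ = 1 / 4 := pow_one _
    calc (Real.pi / n) ^ ((m+1) * n) * ((m+1) * ((n+1) * (HH m n * n ^ n * Real.exp (m * n))))
        ≤ ((4 / n : ℝ) ^ n) ^ m * (2 ^ m * ((n+1) * (((n.factorial * 2 ^ (n + 1)) * ((256 ^ (n + 1) * 4 ^ n) ^ m)) * n ^ n * (3 ^ n) ^ m))) := by
          gcongr
      _ = K1 * (2 ^ m * ((4 / n : ℝ) ^ n * (3 ^ n * (256 ^ (n+1) * 4 ^ n))) ^ m) := by
          rw [mul_pow ((4 / n : ℝ) ^ n), mul_pow ((3:ℝ) ^ n), hK1]; ring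
      _ ≤ K1 * (2 ^ m * (1 / 4) ^ m) := by gcongr
      _ = K1 * (1 / 2 ^ m) := by
          rw [← mul_pow, ← one_div_pow]; norm_num
  have hB : (m+1) * ((n+1) * (HH m n * (n * 5 ^ n))) ≤ K2 * (2 ^ m) ^ (10 * n + 9) := by
    have e : (256:ℝ) ^ (n + 1) * 4 ^ n = 2 ^ (10 * n + 8) := by
      rw [show (256:ℝ) = 2 ^ 8 by norm_num, show (4:ℝ) = 2 ^ 2 by norm_num, ← pow_mul, ← pow_mul, ← pow_add]
      congr 1; ring
    rw [e] at hH
    calc (m+1) * ((n+1) * (HH m n * (n * 5 ^ n)))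
        ≤ 2 ^ m * ((n+1) * (((n.factorial * 2 ^ (n + 1)) * (2 ^ (10 * n + 8)) ^ m) * (n * 5 ^ n))) := by gcongr
      _ = K2 * (2 ^ m * (2 ^ (10 * n + 8)) ^ m) := by rw [hK2]; ring
      _ = K2 * (2 ^ m) ^ (10 * n + 9) := by
          rw [← mul_pow, ← pow_succ', ← pow_mul, ← pow_mul, mul_comm m]
  have hK1' : K1 ≤ K1 + K2 + 1 := by linarith
  have hK2' : K2 ≤ K1 + K2 + 1 := by linarith
  have hA' : K1 * (1 / 2 ^ m) ≤ (K1 + K2 + 1) * (1 / 2 ^ m) := by gcongr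
  have hB' : K2 * (2 ^ m) ^ (10 * n + 9) ≤ (K1 + K2 + 1) * (2 ^ m) ^ (10 * n + 9) := by gcongr
  have hA2 := hA.trans hA'
  have hB2 := hB.trans hB'
  gcongr

lemma pi_measure : ∃ (N : ℕ) (c : ℝ), 0 < c ∧ ∀ (p : ℤ) (q : ℕ), 0 < q → p ≠ 0 → |(p:ℝ) / q| ≤ 5 →
    c ≤ (q:ℝ) ^ N * |Real.pi - p / q| := by
  obtain ⟨n, b, K, hK, h⟩ := measure_ineq
  refine ⟨n + n * b, 1 / (2 * K * (4 * K) ^ b), by positivity, ?_⟩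
  intro p q hq hp h5
  have hq1 : (1:ℝ) ≤ q := by exact_mod_cast hq
  have hqn : (1:ℝ) ≤ (q:ℝ) ^ n := one_le_pow₀ hq1
  obtain ⟨m, hm1, hm2⟩ := exists_nat_pow_near (x := 2 * K * (q:ℝ) ^ n) (y := (2:ℝ)) (by nlinarith) (by norm_num)
  have h1 := h (m+1) p q hq hp h5
  have hK0 : 0 < K := by linarith
  have h2 : (q:ℝ) ^ n * (K * (1 / 2 ^ (m+1))) ≤ 1 / 2 := by
    rw [mul_one_div, ← mul_div_assoc, div_le_iff₀ (by positivity)]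
    nlinarith
  have h3 : (2:ℝ) ^ (m+1) ≤ 4 * K * (q:ℝ) ^ n := by rw [pow_succ]; nlinarith
  have h4 : (q:ℝ) ^ n * (K * (2 ^ (m+1)) ^ b * |Real.pi - p / q|) ≤
      (q:ℝ) ^ n * (K * (4 * K * (q:ℝ) ^ n) ^ b * |Real.pi - p / q|) := by gcongr
  rw [mul_add] at h1
  have h5 : 1 / 2 ≤ (q:ℝ) ^ n * (K * (4 * K * (q:ℝ) ^ n) ^ b * |Real.pi - p / q|) := by linarith
  rw [div_le_iff₀ (by positivity)]
  have e : (q:ℝ) ^ (n + n * b) * |Real.pi - p / q| * (2 * K * (4 * K) ^ b) =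
      2 * ((q:ℝ) ^ n * (K * (4 * K * (q:ℝ) ^ n) ^ b * |Real.pi - p / q|)) := by
    rw [mul_pow (4 * K), pow_add, pow_mul]; ring
  rw [e]; linarith

lemma not_liouvilleWith_pi : ∃ N : ℕ, ¬ LiouvilleWith N Real.pi := by
  obtain ⟨N, c, hc, h⟩ := pi_measure
  refine ⟨N + 1, fun hL => ?_⟩
  obtain ⟨C, hC0, hL⟩ := hL.exists_pos
  have hev : ∀ᶠ q : ℕ in Filter.atTop, C + C / c + 1 < (q:ℝ) :=
    (tendsto_natCast_atTop_atTop (R := ℝ)).eventually_gt_atTop _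
  obtain ⟨q, ⟨hq1, p, hne, hlt⟩, hqC⟩ := (hL.and_eventually hev).exists
  have hq0 : 0 < q := hq1
  have hqR : (1:ℝ) ≤ q := by exact_mod_cast hq1
  have hCc : 0 < C / c := by positivity
  rw [Real.rpow_natCast] at hlt
  have hsmall : |Real.pi - p / q| < 1 := by
    refine hlt.trans_le ?_
    rw [div_le_one (by positivity)]
    calc C ≤ q := by linarith
      _ ≤ (q:ℝ) ^ (N+1) := le_self_pow₀ hqR (by omega)
  have hab := abs_lt.1 hsmall
  have h3 := Real.pi_gt_three
  have h4 := Real.pi_le_four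
  have hp : p ≠ 0 := by
    rintro rfl
    simp at hab
    linarith
  have := h p q hq0 hp (by rw [abs_le]; constructor <;> linarith)
  have h6 : (q:ℝ) ^ N * |Real.pi - p / q| < C / q := by
    calc (q:ℝ) ^ N * |Real.pi - p / q| < (q:ℝ) ^ N * (C / (q:ℝ) ^ (N+1)) := by gcongr
      _ = C / q := by rw [pow_succ]; field_simp
  have h7 : c < C / q := this.trans_lt h6
  rw [lt_div_iff₀ (by positivity), mul_comm, ← lt_div_iff₀ hc] at h7
  linarith

end PiNL

theorem liouville_not_int_mul_pi (α : ℝ) (h : Liouville α) :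
    ∀ k : ℤ, α ≠ k * Real.pi := by
  intro k hk
  by_cases hk0 : k = 0
  · subst hk0
    apply h.irrational
    exact ⟨0, by simp [hk]⟩
  · obtain ⟨N, hN⟩ := PiNL.not_liouvilleWith_pi
    apply hN
    have := h.liouvilleWith N
    rw [hk] at this
    exact (LiouvilleWith.int_mul_iff hk0).1 this
end
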